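/- arXiv:2511.02316 — 4 statements merged into one kernel-verified Lean document; each statement's English description precedes it below -/
import Mathlib

section
/- Almost surely, for every fixed integer r ≥ 1 there are infinitely many times n at which the random walk has exactly r favorite sites, i.e. P(#K(n) = r for infinitely many n) = 1. -/
open MeasureTheory ProbabilityTheory Filter Set
open scoped ENNReal NNReal

variable {Ω : Type*}

/-- Partial sums of the steps: `S X n = X 0 + ⋯ + X (n-1)` (the walk started at `0`). -/
noncomputable def S (X : ℕ → Ω → ℤ) (n : ℕ) (ω : Ω) : ℤ :=
  ∑ i ∈ Finset.range n, X i ω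

/-- The local time at site `z` up to time `n`: `ξ(z,n) = #{k : 0 < k ≤ n, S_k = z}`. -/
noncomputable def localTime (X : ℕ → Ω → ℤ) (z : ℤ) (n : ℕ) (ω : Ω) : ℕ :=
  ((Finset.Icc 1 n).filter (fun k => S X k ω = z)).card

/-- The maximal local time `ξ(n) = max_{y ∈ ℤ} ξ(y,n)`. -/
noncomputable def maxLocalTime (X : ℕ → Ω → ℤ) (n : ℕ) (ω : Ω) : ℕ :=
  sSup (Set.range fun z : ℤ => localTime X z n ω)

/-- The set of favorite sites at time `n`: `K(n) = {z : ξ(z,n) = ξ(n)}`. -/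
noncomputable def favSites (X : ℕ → Ω → ℤ) (n : ℕ) (ω : Ω) : Set ℤ :=
  {z : ℤ | localTime X z n ω = maxLocalTime X n ω}

/-- The total local time at site `z`: `ξ(z,∞) = #{k > 0 : S_k = z}` (as an extended natural). -/
noncomputable def totalLocalTime (X : ℕ → Ω → ℤ) (z : ℤ) (ω : Ω) : ℕ∞ :=
  {k : ℕ | 0 < k ∧ S X k ω = z}.encard

/-- `X` is a sequence of i.i.d. steps with `P(X_i = 1) = p`, `P(X_i = -1) = q`. -/
def IsAsymmetricSRW [MeasurableSpace Ω] (P : Measure Ω) (X : ℕ → Ω → ℤ) (p q : ℝ) : Prop :=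
  (∀ i, Measurable (X i)) ∧
  iIndepFun X P ∧
  (∀ i, P {ω | X i ω = 1} = ENNReal.ofReal p) ∧
  (∀ i, P {ω | X i ω = -1} = ENNReal.ofReal q)

lemma fs_L_succ (X : ℕ → Ω → ℤ) (z : ℤ) (n : ℕ) (ω : Ω) :
    localTime X z (n+1) ω = localTime X z n ω + if S X (n+1) ω = z then 1 else 0 := by
  unfold localTime
  rw [← Finset.insert_Icc_right_eq_Icc_add_one (by omega), Finset.filter_insert]
  split_ifs with h
  · rw [Finset.card_insert_of_notMem (by simp)]
  · simp

lemma fs_L_le (X : ℕ → Ω → ℤ) (z : ℤ) (n : ℕ) (ω : Ω) : localTime X z n ω ≤ n := by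
  unfold localTime
  exact (Finset.card_filter_le _ _).trans (by simp)

lemma fs_bdd (X : ℕ → Ω → ℤ) (n : ℕ) (ω : Ω) :
    BddAbove (Set.range fun z : ℤ => localTime X z n ω) :=
  ⟨n, by rintro _ ⟨z, rfl⟩; exact fs_L_le X z n ω⟩

lemma fs_L_le_max (X : ℕ → Ω → ℤ) (z : ℤ) (n : ℕ) (ω : Ω) :
    localTime X z n ω ≤ maxLocalTime X n ω :=
  le_csSup (fs_bdd X n ω) ⟨z, rfl⟩

lemma fs_max_attained (X : ℕ → Ω → ℤ) (n : ℕ) (ω : Ω) :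
    ∃ z, localTime X z n ω = maxLocalTime X n ω :=
  Nat.sSup_mem (Set.range_nonempty _) (fs_bdd X n ω)

lemma fs_max_eq (X : ℕ → Ω → ℤ) (n : ℕ) (ω : Ω) (m : ℕ) (h : ∀ z, localTime X z n ω ≤ m)
    (z : ℤ) (hz : localTime X z n ω = m) : maxLocalTime X n ω = m := by
  obtain ⟨y, hy⟩ := fs_max_attained X n ω
  exact le_antisymm (hy ▸ h y) (hz ▸ fs_L_le_max X z n ω)

lemma fs_L_mono (X : ℕ → Ω → ℤ) (z : ℤ) (ω : Ω) : Monotone fun n => localTime X z n ω :=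
  monotone_nat_of_le_succ fun n => by rw [fs_L_succ]; omega

lemma fs_max_mono (X : ℕ → Ω → ℤ) (ω : Ω) : Monotone fun n => maxLocalTime X n ω := by
  intro a b hab
  obtain ⟨y, hy⟩ := fs_max_attained X a ω
  show maxLocalTime X a ω ≤ maxLocalTime X b ω
  rw [← hy]
  exact (fs_L_mono X y ω hab).trans (fs_L_le_max X y b ω)

/-- at time `n` there are exactly `r` favourites and the walk sits at the rightmost one. -/
def FsB (X : ℕ → Ω → ℤ) (r n : ℕ) (ω : Ω) : Prop :=
  (favSites X n ω).ncard = r ∧ S X n ω ∈ favSites X n ω ∧ ∀ z ∈ favSites X n ω, z ≤ S X n ω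

lemma fs_first (X : ℕ → Ω → ℤ) (ω : Ω) (hub : ∀ m, ∃ n, m ≤ maxLocalTime X n ω) (N : ℕ) :
    ∃ n, N < n ∧ localTime X (S X n ω) n ω = maxLocalTime X N ω + 1 ∧ favSites X n ω = {S X n ω} := by
  classical
  have hex : ∃ n, maxLocalTime X N ω < maxLocalTime X n ω := by
    obtain ⟨n, hn⟩ := hub (maxLocalTime X N ω + 1)
    exact ⟨n, hn⟩
  obtain ⟨n, hn, hmin⟩ : ∃ n, maxLocalTime X N ω < maxLocalTime X n ω ∧
      ∀ k < n, maxLocalTime X k ω ≤ maxLocalTime X N ω :=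
    ⟨Nat.find hex, Nat.find_spec hex, fun k hk => not_lt.mp (Nat.find_min hex hk)⟩
  have hNn : N < n := by
    by_contra h
    exact absurd (fs_max_mono X ω (not_lt.mp h)) (not_le.mpr hn)
  obtain ⟨k, rfl⟩ : ∃ k, n = k + 1 := ⟨n - 1, by omega⟩
  have hk := hmin k (by omega)
  have key : ∀ z, maxLocalTime X N ω < localTime X z (k+1) ω →
      z = S X (k+1) ω ∧ localTime X z (k+1) ω = maxLocalTime X N ω + 1 := by
    intro z hz
    have h1 := fs_L_le_max X z k ω
    rw [fs_L_succ] at hz ⊢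
    split_ifs at hz ⊢ with h
    · exact ⟨h.symm, by omega⟩
    · omega
  obtain ⟨y, hy⟩ := fs_max_attained X (k+1) ω
  have h2 := key y (by omega)
  refine ⟨k+1, hNn, h2.1 ▸ h2.2, ?_⟩
  ext z
  simp only [favSites, Set.mem_setOf_eq, Set.mem_singleton_iff]
  constructor
  · intro hz; exact (key z (by omega)).1
  · rintro rfl; rw [← h2.1]; exact hy

lemma fs_base (X : ℕ → Ω → ℤ) (ω : Ω) (hub : ∀ m, ∃ n, m ≤ maxLocalTime X n ω) :
    ∃ᶠ n in atTop, FsB X 1 n ω := by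
  rw [frequently_atTop]
  intro N
  obtain ⟨n, h1, -, h3⟩ := fs_first X ω hub N
  exact ⟨n, h1.le, by simp [FsB, h3]⟩

lemma fs_step (X : ℕ → Ω → ℤ) (ω : Ω) (hub : ∀ m, ∃ n, m ≤ maxLocalTime X n ω) (r n : ℕ)
    (hr : 1 ≤ r) (hB : FsB X r n ω) (hG : ∀ k, n < k → S X n ω < S X k ω) :
    ∃ n', n < n' ∧ FsB X (r+1) n' ω := by
  classical
  obtain ⟨hB1, hB2, hB3⟩ := hB
  set m := maxLocalTime X n ω with hm
  have hex : ∃ k, n < k ∧ m ≤ localTime X (S X k ω) k ω := by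
    obtain ⟨k, h1, h2, -⟩ := fs_first X ω hub n
    exact ⟨k, h1, by omega⟩
  obtain ⟨n', ⟨hn', hge⟩, hmin⟩ : ∃ k, (n < k ∧ m ≤ localTime X (S X k ω) k ω) ∧
      ∀ j < k, ¬ (n < j ∧ m ≤ localTime X (S X j ω) j ω) :=
    ⟨Nat.find hex, Nat.find_spec hex, fun k hk => Nat.find_min hex hk⟩
  have hleft : ∀ j, n ≤ j → ∀ z ≤ S X n ω, localTime X z j ω = localTime X z n ω := by
    intro j hj
    induction j, hj using Nat.le_induction with
    | base => intros; rfl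
    | succ j hj ih =>
      intro z hz
      have := hG (j+1) (by omega)
      rw [fs_L_succ, if_neg (by omega), ih z hz, add_zero]
  have hright : ∀ j, n ≤ j → j < n' → ∀ z, S X n ω < z → localTime X z j ω < m := by
    intro j hj
    induction j, hj using Nat.le_induction with
    | base =>
      intro _ z hz
      refine lt_of_le_of_ne (fs_L_le_max X z n ω) fun h => ?_
      have := hB3 z h
      omega
    | succ j hj ih =>
      intro hlt z hz
      by_cases h : S X (j+1) ω = z
      · have := hmin (j+1) hlt
        rw [h] at this
        by_contra h'
        exact this ⟨by omega, by omega⟩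
      · rw [fs_L_succ, if_neg h, add_zero]
        exact ih (by omega) z hz
  obtain ⟨k, rfl⟩ : ∃ k, n' = k + 1 := ⟨n' - 1, by omega⟩
  have hS := hG (k+1) hn'
  have hR := hright k (by omega) (by omega)
  have hSm : localTime X (S X (k+1) ω) (k+1) ω = m := by
    have := hR _ hS
    rw [fs_L_succ, if_pos rfl] at hge ⊢
    omega
  have hR' : ∀ z, S X n ω < z → z ≠ S X (k+1) ω → localTime X z (k+1) ω < m := by
    intro z hz hne
    rw [fs_L_succ, if_neg (Ne.symm hne), add_zero]
    exact hR z hz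
  have hmax : maxLocalTime X (k+1) ω = m := by
    refine fs_max_eq X _ ω m (fun z => ?_) _ hSm
    rcases le_or_gt z (S X n ω) with hz | hz
    · rw [hleft _ hn'.le z hz]; exact fs_L_le_max X z n ω
    · by_cases h : z = S X (k+1) ω
      · rw [h, hSm]
      · exact (hR' z hz h).le
  have hK : favSites X (k+1) ω = insert (S X (k+1) ω) (favSites X n ω) := by
    ext z
    simp only [favSites, Set.mem_setOf_eq, Set.mem_insert_iff, hmax, ← hm]
    rcases le_or_gt z (S X n ω) with hz | hz
    · rw [hleft _ hn'.le z hz]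
      constructor
      · exact Or.inr
      · rintro (h | h)
        · omega
        · exact h
    · by_cases h : z = S X (k+1) ω
      · simp [h, hSm]
      · have h1 := hR' z hz h
        have h2 : localTime X z n ω ≠ m := fun h => by
          have := hB3 z h
          omega
        simp only [h, h2, or_self, iff_false]
        omega
  refine ⟨k+1, hn', ?_, ?_, ?_⟩
  · rw [hK, Set.ncard_insert_of_notMem _ (Set.finite_of_ncard_pos (by omega)), hB1]
    intro h
    have := hB3 _ h
    omega
  · rw [hK]; exact Set.mem_insert _ _
  · intro z hz
    rw [hK] at hz
    rcases hz with rfl | hz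
    · exact le_rfl
    · have := hB3 z hz
      omega

lemma fs_B_congr {Ω' : Type*} (X : ℕ → Ω → ℤ) (Y : ℕ → Ω' → ℤ) (ω : Ω) (ω' : Ω') (r n : ℕ)
    (h : ∀ i < n, X i ω = Y i ω') : FsB X r n ω ↔ FsB Y r n ω' := by
  have hS : ∀ k ≤ n, S X k ω = S Y k ω' := fun k hk =>
    Finset.sum_congr rfl fun i hi => h i (by have := Finset.mem_range.mp hi; omega)
  have hL : ∀ z, localTime X z n ω = localTime Y z n ω' := by
    intro z
    unfold localTime
    congr 1
    refine Finset.filter_congr fun k hk => ?_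
    rw [hS k (Finset.mem_Icc.mp hk).2]
  have hM : maxLocalTime X n ω = maxLocalTime Y n ω' := by
    simp only [maxLocalTime, hL]
  have hK : favSites X n ω = favSites Y n ω' := by
    simp only [favSites, hL, hM]
  simp only [FsB, hK, hS n le_rfl]

section fsprob
variable [MeasurableSpace Ω]

def fsSig (X : ℕ → Ω → ℤ) (n : ℕ) : MeasurableSpace Ω :=
  ⨆ i ∈ Set.Iio n, MeasurableSpace.comap (X i) inferInstance

def fsTail (X : ℕ → Ω → ℤ) (n : ℕ) : MeasurableSpace Ω :=
  ⨆ i ∈ Set.Ici n, MeasurableSpace.comap (X i) inferInstance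

lemma fs_comap_le (X : ℕ → Ω → ℤ) (hm : ∀ i, Measurable (X i)) (A : Set ℕ) :
    (⨆ i ∈ A, MeasurableSpace.comap (X i) inferInstance) ≤ ‹MeasurableSpace Ω› :=
  iSup₂_le fun i _ => (hm i).comap_le

def fsFil (X : ℕ → Ω → ℤ) (hm : ∀ i, Measurable (X i)) :
    Filtration ℕ ‹MeasurableSpace Ω› where
  seq := fsSig X
  mono' := fun _ _ h => biSup_mono fun _ hi => lt_of_lt_of_le hi h
  le' := fun _ => fs_comap_le X hm _

lemma fs_meas_sig (X : ℕ → Ω → ℤ) (n i : ℕ) (h : i < n) : Measurable[fsSig X n] (X i) := by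
  refine Measurable.mono (comap_measurable (X i)) ?_ le_rfl
  exact le_iSup₂_of_le (f := fun j (_ : j ∈ Set.Iio n) => MeasurableSpace.comap (X j) inferInstance)
    i h le_rfl

lemma fs_meas_tail (X : ℕ → Ω → ℤ) (n i : ℕ) (h : n ≤ i) : Measurable[fsTail X n] (X i) := by
  refine Measurable.mono (comap_measurable (X i)) ?_ le_rfl
  exact le_iSup₂_of_le (f := fun j (_ : j ∈ Set.Ici n) => MeasurableSpace.comap (X j) inferInstance)
    i h le_rfl

lemma fs_tail_le_sup (X : ℕ → Ω → ℤ) (hm : ∀ i, Measurable (X i)) (n : ℕ) :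
    fsTail X n ≤ ⨆ k, fsFil X hm k := by
  refine iSup₂_le fun i _ => ?_
  refine le_trans ?_ (le_iSup (fun k => (fsFil X hm k)) (i+1))
  exact (fs_meas_sig X (i+1) i (by omega)).comap_le

def fsShift (X : ℕ → Ω → ℤ) (n : ℕ) (ω : Ω) : ℕ → ℤ := fun i => X (n + i) ω

lemma fs_shift_meas (X : ℕ → Ω → ℤ) (n : ℕ) : Measurable[fsTail X n] (fsShift X n) :=
  (@measurable_pi_iff _ _ _ (fsTail X n) _ _).mpr fun i => fs_meas_tail X n (n+i) (by omega)

lemma fs_indep (P : Measure Ω) [IsProbabilityMeasure P] (X : ℕ → Ω → ℤ)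
    (hm : ∀ i, Measurable (X i)) (hi : iIndepFun X P) (n : ℕ) :
    Indep (fsTail X n) (fsSig X n) P := by
  refine indep_iSup_of_disjoint (fun i => (hm i).comap_le) hi.iIndep ?_
  rw [Set.disjoint_left]
  intro a h1 h2
  exact absurd (Set.mem_Iio.mp h2) (not_lt.mpr h1)

lemma fs_levy (P : Measure Ω) [IsProbabilityMeasure P] (X : ℕ → Ω → ℤ)
    (hm : ∀ i, Measurable (X i)) (hi : iIndepFun X P)
    (hst : ∀ n, P.map (fsShift X n) = P.map (fsShift X 0))
    (E : Set (ℕ → ℤ)) (hE : MeasurableSet E) (hpos : P.map (fsShift X 0) E ≠ 0)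
    (B : ℕ → Set Ω) (hB : ∀ n, MeasurableSet[fsSig X n] (B n)) :
    ∀ᵐ ω ∂P, (∃ᶠ n in atTop, ω ∈ B n) → ∃ᶠ n in atTop, ω ∈ B n ∧ fsShift X n ω ∈ E := by
  have hsig : ∀ n, fsSig X n ≤ ‹MeasurableSpace Ω› := fun n => fs_comap_le X hm _
  have htail : ∀ n, fsTail X n ≤ ‹MeasurableSpace Ω› := fun n => fs_comap_le X hm _
  have hshm : ∀ n, Measurable (fsShift X n) := fun n => (fs_shift_meas X n).mono (htail n) le_rfl
  set c : ℝ := (P.map (fsShift X 0)).real E with hc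
  have hcpos : 0 < c := by
    have : IsProbabilityMeasure (P.map (fsShift X 0)) :=
      Measure.isProbabilityMeasure_map (hshm 0).aemeasurable
    exact ENNReal.toReal_pos hpos (measure_ne_top _ _)
  let G : ℕ → Set Ω := fun n => fsShift X n ⁻¹' E
  have hGt : ∀ n, MeasurableSet[fsTail X n] (G n) := fun n => fs_shift_meas X n hE
  have hGP : ∀ n, P.real (G n) = c := by
    intro n
    rw [hc, ← hst n, map_measureReal_apply (hshm n) hE]
  let U : ℕ → Set Ω := fun N => ⋃ n, ⋃ (_ : N ≤ n), (B n ∩ G n)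
  have hUsup : ∀ N, MeasurableSet[⨆ k, fsFil X hm k] (U N) := by
    intro N
    refine MeasurableSet.iUnion fun n => MeasurableSet.iUnion fun _ => MeasurableSet.inter ?_ ?_
    · exact le_iSup (fun k => (fsFil X hm k)) n _ (hB n)
    · exact fs_tail_le_sup X hm n _ (hGt n)
  have hUm : ∀ N, MeasurableSet (U N) := fun N =>
    (iSup_le fun n => (fsFil X hm).le n : (⨆ k, fsFil X hm k) ≤ _) _ (hUsup N)
  have hlim : ∀ N, ∀ᵐ ω ∂P, Tendsto (fun n => (P[(U N).indicator (fun _ => (1:ℝ)) | fsFil X hm n]) ω)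
      atTop (nhds ((U N).indicator (fun _ => (1:ℝ)) ω)) := by
    intro N
    refine Integrable.tendsto_ae_condExp ((integrable_const _).indicator (hUm N)) ?_
    exact stronglyMeasurable_const.indicator (hUsup N)
  have hlow : ∀ N n, N ≤ n → ∀ᵐ ω ∂P, ω ∈ B n →
      c ≤ (P[(U N).indicator (fun _ => (1:ℝ)) | fsFil X hm n]) ω := by
    intro N n hNn
    have hGm := htail n _ (hGt n)
    have hBm := hsig n _ (hB n)
    have h1 : P[(B n).indicator ((G n).indicator (fun _ => (1:ℝ))) | fsFil X hm n] ≤ᵐ[P]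
        P[(U N).indicator (fun _ => (1:ℝ)) | fsFil X hm n] := by
      refine condExp_mono (((integrable_const _).indicator hGm).indicator hBm)
        ((integrable_const _).indicator (hUm N)) (Eventually.of_forall fun ω => ?_)
      rw [Set.indicator_indicator]
      refine Set.indicator_le_indicator_of_subset ?_ (fun _ => zero_le_one) ω
      exact Set.subset_iUnion₂_of_subset n hNn subset_rfl
    have h2 : P[(B n).indicator ((G n).indicator (fun _ => (1:ℝ))) | fsFil X hm n] =ᵐ[P]
        (B n).indicator (P[(G n).indicator (fun _ => (1:ℝ)) | fsFil X hm n]) :=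
      condExp_indicator ((integrable_const _).indicator hGm) (hB n)
    have h3 : P[(G n).indicator (fun _ => (1:ℝ)) | fsFil X hm n] =ᵐ[P]
        fun _ => P[(G n).indicator (fun _ => (1:ℝ))] :=
      condExp_indep_eq (htail n) ((fsFil X hm).le n)
        (stronglyMeasurable_const.indicator (hGt n)) (fs_indep P X hm hi n)
    filter_upwards [h1, h2, h3] with ω h1 h2 h3 hω
    rw [h2, Set.indicator_of_mem hω, h3, integral_indicator_const _ hGm, hGP] at h1
    simpa using h1
  have hlow' := ae_all_iff.mpr fun N => ae_all_iff.mpr fun n =>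
    (Filter.eventually_imp_distrib_left (p := N ≤ n)).mpr (hlow N n)
  filter_upwards [ae_all_iff.mpr hlim, hlow'] with ω h1 h2 hfr
  rw [frequently_atTop]
  intro N
  by_contra hcon
  have hU : ω ∉ U N := by
    intro h
    simp only [U, Set.mem_iUnion] at h
    obtain ⟨n, hn, hh⟩ := h
    exact hcon ⟨n, hn, hh⟩
  have h3 := h1 N
  rw [Set.indicator_of_notMem hU] at h3
  have h4 := h3.eventually (gt_mem_nhds hcpos)
  obtain ⟨n, hn1, hn2, hn3⟩ := (hfr.and_eventually (h4.and (eventually_ge_atTop N))).exists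
  exact absurd (h2 N n hn3 hn1) (not_le.mpr hn2)

lemma fs_B_meas (X : ℕ → Ω → ℤ) (r n : ℕ) : MeasurableSet[fsSig X n] {ω | FsB X r n ω} := by
  let Y : ℕ → (ℕ → ℤ) → ℤ := fun i x => x i
  let ext : (Fin n → ℤ) → (ℕ → ℤ) := fun y i => if h : i < n then y ⟨i, h⟩ else 0
  let f : Ω → (Fin n → ℤ) := fun ω i => X i ω
  have hf : Measurable[fsSig X n] f :=
    (@measurable_pi_iff _ _ _ (fsSig X n) _ _).mpr fun i => fs_meas_sig X n i i.2
  have : {ω | FsB X r n ω} = f ⁻¹' {y | FsB Y r n (ext y)} := by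
    ext ω
    refine fs_B_congr X Y ω (ext (f ω)) r n fun i hi => ?_
    simp [Y, ext, f, hi]
  rw [this]
  exact hf (MeasurableSet.of_discrete)

lemma fs_law (P : Measure Ω) [IsProbabilityMeasure P] (X : ℕ → Ω → ℤ) (p q : ℝ)
    (hp0 : 0 < p) (hq0 : 0 < q) (hpq : p + q = 1)
    (hX : IsAsymmetricSRW P X p q) (i : ℕ) :
    P.map (X i) = ENNReal.ofReal p • Measure.dirac 1 + ENNReal.ofReal q • Measure.dirac (-1) := by
  obtain ⟨hm, -, h1, h2⟩ := hX
  have hpr : IsProbabilityMeasure (P.map (X i)) := Measure.isProbabilityMeasure_map (hm i).aemeasurable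
  have e1 : P.map (X i) {1} = ENNReal.ofReal p := by
    rw [Measure.map_apply (hm i) (measurableSet_singleton _)]; exact h1 i
  have e2 : P.map (X i) {-1} = ENNReal.ofReal q := by
    rw [Measure.map_apply (hm i) (measurableSet_singleton _)]; exact h2 i
  have e3 : P.map (X i) {1, -1} = 1 := by
    rw [Set.insert_eq, measure_union (by simp) (measurableSet_singleton _), e1, e2,
      ← ENNReal.ofReal_add hp0.le hq0.le, hpq, ENNReal.ofReal_one]
  have e4 : P.map (X i) {1, -1}ᶜ = 0 := (prob_compl_eq_zero_iff (by measurability)).mpr e3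
  refine Measure.ext_of_singleton fun z => ?_
  by_cases hz1 : z = 1
  · subst hz1; simp [e1]
  by_cases hz2 : z = -1
  · subst hz2; simp [e2]
  have : P.map (X i) {z} = 0 := measure_mono_null (by simp [hz1, hz2]) e4
  rw [this]
  simp [Ne.symm hz1, Ne.symm hz2]

lemma fs_stat (P : Measure Ω) [IsProbabilityMeasure P] (X : ℕ → Ω → ℤ) (p q : ℝ)
    (hp0 : 0 < p) (hq0 : 0 < q) (hpq : p + q = 1)
    (hX : IsAsymmetricSRW P X p q) (n : ℕ) :
    P.map (fsShift X n) = P.map (fsShift X 0) := by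
  have key : ∀ n, P.map (fsShift X n) = Measure.infinitePi fun _ : ℕ =>
      (ENNReal.ofReal p • Measure.dirac (1:ℤ) + ENNReal.ofReal q • Measure.dirac (-1)) := by
    intro n
    have h := (hX.2.1.precomp (g := fun i => n + i) (add_right_injective n)).map_fun_eq_infinitePi_map
      (fun i => hX.1 _)
    simp only [fs_law P X p q hp0 hq0 hpq hX] at h
    exact h
  rw [key n, key 0]

lemma fs_S_add (X : ℕ → Ω → ℤ) (n k : ℕ) (ω : Ω) :
    S X (n + k) ω = S X n ω + ∑ i ∈ Finset.range k, fsShift X n ω i := by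
  simp [S, Finset.sum_range_add, fsShift]

lemma fs_tendsto (P : Measure Ω) [IsProbabilityMeasure P] (X : ℕ → Ω → ℤ) (p q : ℝ)
    (hp0 : 0 < p) (hq0 : 0 < q) (hqp : q < p) (hpq : p + q = 1)
    (hX : IsAsymmetricSRW P X p q) :
    ∀ᵐ ω ∂P, Tendsto (fun n => S X n ω) atTop atTop := by
  have hlaw := fs_law P X p q hp0 hq0 hpq hX
  have hm := hX.1
  have hcast : Measurable (fun z : ℤ => (z : ℝ)) := measurable_from_top
  have hint' : Integrable (fun z : ℤ => (z : ℝ)) (P.map (X 0)) := by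
    rw [hlaw]
    refine Integrable.add_measure ?_ ?_ <;>
    exact (integrable_dirac (by simp)).smul_measure ENNReal.ofReal_ne_top
  have hE : ∫ ω, (X 0 ω : ℝ) ∂P = p - q := by
    have := integral_map (hm 0).aemeasurable (f := fun z : ℤ => (z : ℝ)) hint'.aestronglyMeasurable
    rw [← this]
    rw [hlaw, integral_add_measure, integral_smul_measure, integral_smul_measure]
    · simp [hp0.le, hq0.le]; ring
    · exact (integrable_dirac (by simp)).smul_measure ENNReal.ofReal_ne_top
    · exact (integrable_dirac (by simp)).smul_measure ENNReal.ofReal_ne_top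
  have hsl := strong_law_ae_real (μ := P) (fun i ω => (X i ω : ℝ))
    ((integrable_map_measure hint'.aestronglyMeasurable (hm 0).aemeasurable).mp hint')
    (fun i j hij => (hX.2.1.indepFun hij).comp hcast hcast)
    (fun i => (IdentDistrib.mk (hm i).aemeasurable (hm 0).aemeasurable
      (by rw [hlaw, hlaw])).comp hcast)
  filter_upwards [hsl] with ω hω
  rw [hE] at hω
  have h1 : Tendsto (fun n : ℕ => (n : ℝ) * ((∑ i ∈ Finset.range n, (X i ω : ℝ)) / n)) atTop atTop :=
    tendsto_natCast_atTop_atTop.atTop_mul_pos (by linarith) hω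
  rw [← tendsto_intCast_atTop_iff (R := ℝ)]
  refine h1.congr' ?_
  filter_upwards [eventually_gt_atTop 0] with n hn
  have : (n : ℝ) ≠ 0 := by positivity
  simp only [S]
  push_cast
  field_simp

def fsPos : Set (ℕ → ℤ) := {x | ∀ k, 0 < k → 0 < ∑ i ∈ Finset.range k, x i}

lemma fsPos_meas : MeasurableSet fsPos := by
  have : fsPos = ⋂ k, ⋂ (_ : 0 < k), {x : ℕ → ℤ | 0 < ∑ i ∈ Finset.range k, x i} := by
    ext x; simp [fsPos]
  rw [this]
  refine MeasurableSet.iInter fun k => MeasurableSet.iInter fun _ => ?_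
  exact measurableSet_lt measurable_const (by fun_prop)

lemma fs_last_min (s : ℕ → ℤ) (h : Tendsto s atTop atTop) : ∃ n, ∀ k, n < k → s n < s k := by
  obtain ⟨N, hN⟩ := (h.eventually_gt_atTop (s 0)).exists_forall_of_atTop
  classical
  obtain ⟨n, hn, hmin⟩ := Finset.exists_min_image (Finset.range (N+1))
    (fun k => (toLex (s k, -(k:ℤ)))) ⟨0, by simp⟩
  refine ⟨n, fun k hk => ?_⟩
  have h0 := hmin 0 (by simp)
  simp only [Prod.Lex.toLex_le_toLex] at h0 hmin
  by_cases hkN : k < N + 1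
  · have := hmin k (by simpa using hkN)
    omega
  · have := hN k (by omega)
    omega

lemma fs_pos (P : Measure Ω) [IsProbabilityMeasure P] (X : ℕ → Ω → ℤ) (p q : ℝ)
    (hp0 : 0 < p) (hq0 : 0 < q) (hqp : q < p) (hpq : p + q = 1)
    (hX : IsAsymmetricSRW P X p q) : P.map (fsShift X 0) fsPos ≠ 0 := by
  intro h0
  have hshm : ∀ n, Measurable (fsShift X n) := fun n => measurable_pi_iff.mpr fun i => hX.1 _
  have h1 : ∀ n, ∀ᵐ ω ∂P, fsShift X n ω ∉ fsPos := by
    intro n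
    rw [← fs_stat P X p q hp0 hq0 hpq hX n, Measure.map_apply (hshm n) fsPos_meas] at h0
    exact measure_eq_zero_iff_ae_notMem.mp h0
  have h2 : ∀ᵐ ω ∂P, False := by
    filter_upwards [ae_all_iff.mpr h1, fs_tendsto P X p q hp0 hq0 hqp hpq hX] with ω h1 h2
    obtain ⟨n, hn⟩ := fs_last_min _ h2
    refine h1 n fun k hk => ?_
    have := hn (n+k) (by omega)
    rw [fs_S_add] at this
    omega
  simp at h2
  exact IsProbabilityMeasure.ne_zero P h2

def fsPat (m : ℕ) : Set (ℕ → ℤ) := {x | ∀ i ∈ Finset.range (2*m), x i = (-1)^i}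

lemma fsPat_eq (m : ℕ) : fsPat m = ⋂ i ∈ Finset.range (2*m), {x : ℕ → ℤ | x i = (-1)^i} := by
  ext x; simp [fsPat]

lemma fsPat_meas (m : ℕ) : MeasurableSet (fsPat m) := by
  rw [fsPat_eq]
  refine Finset.measurableSet_biInter _ fun i _ => ?_
  exact measurableSet_eq_fun (measurable_pi_apply i) measurable_const

lemma fs_pat_pos (P : Measure Ω) [IsProbabilityMeasure P] (X : ℕ → Ω → ℤ) (p q : ℝ)
    (hp0 : 0 < p) (hq0 : 0 < q)
    (hX : IsAsymmetricSRW P X p q) (m : ℕ) : P.map (fsShift X 0) (fsPat m) ≠ 0 := by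
  have hshm : ∀ n, Measurable (fsShift X n) := fun n => measurable_pi_iff.mpr fun i => hX.1 _
  rw [Measure.map_apply (hshm 0) (fsPat_meas m)]
  have : fsShift X 0 ⁻¹' fsPat m = ⋂ i ∈ Finset.range (2*m), (X i) ⁻¹' {(-1)^i} := by
    ext ω; simp [fsPat, fsShift]
  rw [this, hX.2.1.meas_biInter (fun i _ => ⟨_, measurableSet_singleton _, rfl⟩)]
  refine Finset.prod_ne_zero_iff.mpr fun i _ => ?_
  rcases neg_one_pow_eq_or ℤ i with h | h
  · rw [h]
    have := hX.2.2.1 i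
    change P {ω | X i ω = 1} ≠ 0
    rw [this]; simpa using hp0
  · rw [h]
    have := hX.2.2.2 i
    change P {ω | X i ω = -1} ≠ 0
    rw [this]; simpa using hq0

lemma fs_pat_local (X : ℕ → Ω → ℤ) (n m : ℕ) (ω : Ω) (h : fsShift X n ω ∈ fsPat m) :
    m ≤ maxLocalTime X (n + 2*m) ω := by
  have hS : ∀ j ≤ m, S X (n + 2*j) ω = S X n ω := by
    intro j hj
    induction j with
    | zero => simp
    | succ j ih =>
      have a := h (2*j) (by simp; omega)
      have b := h (2*j+1) (by simp; omega)
      have i1 := ih (by omega)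
      rw [fs_S_add] at i1 ⊢
      rw [show 2*(j+1) = 2*j+1+1 by ring, Finset.sum_range_succ, Finset.sum_range_succ, a, b]
      rw [pow_succ, pow_mul]
      simp at i1 ⊢
      exact i1
  refine le_trans ?_ (fs_L_le_max X (S X n ω) _ ω)
  unfold localTime
  have : ((Finset.range m).image fun j => n + 2*(j+1)).card = m := by
    rw [Finset.card_image_of_injective _ (fun a b hab => by simp at hab; omega), Finset.card_range]
  conv_lhs => rw [← this]
  refine Finset.card_le_card fun k hk => ?_
  simp only [Finset.mem_image, Finset.mem_range] at hk
  obtain ⟨j, hj, rfl⟩ := hk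
  simp only [Finset.mem_filter, Finset.mem_Icc]
  exact ⟨by omega, hS (j+1) (by omega)⟩

end fsprob
/-- Almost surely, for every fixed integer `r ≥ 1` there are infinitely many times `n`
at which the walk has exactly `r` favorite sites. -/
theorem favorite_sites_infinitely_often
    [MeasurableSpace Ω] (P : Measure Ω) [IsProbabilityMeasure P]
    (X : ℕ → Ω → ℤ) (p q : ℝ) (hq0 : 0 < q) (hq : q < 1/2) (hpq : p + q = 1)
    (hX : IsAsymmetricSRW P X p q) :
    ∀ᵐ ω ∂P, ∀ r : ℕ, 1 ≤ r → ∃ᶠ n in atTop, (favSites X n ω).ncard = r := by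
  have hp0 : 0 < p := by linarith
  have hqp : q < p := by linarith
  have hst := fs_stat P X p q hp0 hq0 hpq hX
  have hlev := fs_levy P X hX.1 hX.2.1 hst
  have hub : ∀ᵐ ω ∂P, ∀ m, ∃ n, m ≤ maxLocalTime X n ω := by
    rw [ae_all_iff]
    intro m
    filter_upwards [hlev (fsPat m) (fsPat_meas m) (fs_pat_pos P X p q hp0 hq0 hX m)
      (fun _ => Set.univ) (fun _ => MeasurableSet.univ)] with ω h
    obtain ⟨n, -, hn⟩ := (h (Eventually.of_forall fun _ => Set.mem_univ _).frequently).exists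
    exact ⟨_, fs_pat_local X n m ω hn⟩
  have hB : ∀ᵐ ω ∂P, ∀ r, (∃ᶠ n in atTop, FsB X r n ω) →
      ∃ᶠ n in atTop, FsB X r n ω ∧ fsShift X n ω ∈ fsPos := by
    rw [ae_all_iff]
    intro r
    exact hlev fsPos fsPos_meas (fs_pos P X p q hp0 hq0 hqp hpq hX)
      (fun n => {ω | FsB X r n ω}) (fs_B_meas X r)
  filter_upwards [hub, hB] with ω h1 h2 r hr
  suffices h : ∃ᶠ n in atTop, FsB X r n ω from h.mono fun n hn => hn.1
  induction r, hr using Nat.le_induction with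
  | base => exact fs_base X ω h1
  | succ r hr ih =>
    rw [frequently_atTop]
    intro N
    obtain ⟨n, hn, hb, hg⟩ := (frequently_atTop.mp (h2 r ih)) N
    obtain ⟨n', hn', hb'⟩ := fs_step X ω h1 r n hr hb (fun k hk => by
      obtain ⟨j, rfl⟩ := Nat.exists_eq_add_of_lt hk
      have := hg (j+1) (by omega)
      rw [add_assoc, fs_S_add]
      omega)
    exact ⟨n', by omega, hb'⟩
end

section
/- Almost surely, limsup_{n→∞} #K(n) / log log n = -1 / log(1 - 2q). -/
open MeasureTheory ProbabilityTheory Filter Set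
open scoped ENNReal NNReal

variable {Ω : Type*}

namespace FavW

/-- step of the walk -/
def st (b : Bool) : ℤ := if b then 1 else -1

/-- position, newest step first -/
def pos : List Bool → ℤ
  | [] => 0
  | b :: l => pos l + st b

/-- local time -/
def loc (z : ℤ) : List Bool → ℕ
  | [] => 0
  | b :: l => loc z l + if pos l + st b = z then 1 else 0

/-- max local time -/
def mx : List Bool → ℕ
  | [] => 0
  | b :: l => max (mx l) (loc (pos l + st b) l + 1)

/-- number of sites at level at least `k` -/
def cnt (k : ℕ) : List Bool → ℕ
  | [] => 0
  | b :: l => cnt k l + if loc (pos l + st b) l + 1 = k then 1 else 0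

/-- expectation over `n` steps -/
noncomputable def Ex (p q : ℝ) : ℕ → (List Bool → ℝ) → ℝ
  | 0, f => f []
  | n + 1, f => Ex p q n (fun l => p * f (true :: l) + q * f (false :: l))

lemma loc_cons (z : ℤ) (b : Bool) (l : List Bool) :
    loc z (b :: l) = loc z l + if pos l + st b = z then 1 else 0 := rfl

lemma loc_self (b : Bool) (l : List Bool) :
    loc (pos l + st b) (b :: l) = loc (pos l + st b) l + 1 := by simp [loc]

lemma loc_ne {z : ℤ} {b : Bool} {l : List Bool} (h : pos l + st b ≠ z) :
    loc z (b :: l) = loc z l := by simp [loc, h]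

lemma loc_le_cons (z : ℤ) (b : Bool) (l : List Bool) : loc z l ≤ loc z (b :: l) := by
  simp [loc]

lemma loc_le_mx (z : ℤ) (l : List Bool) : loc z l ≤ mx l := by
  induction l with
  | nil => simp [loc]
  | cons b l ih =>
    simp only [loc, mx]
    split_ifs with h
    · subst h; exact le_max_right _ _
    · exact le_trans (by simpa using ih) (le_max_left _ _)

lemma exists_loc_eq_mx (l : List Bool) : ∃ z, loc z l = mx l := by
  induction l with
  | nil => exact ⟨0, rfl⟩
  | cons b l ih =>
    obtain ⟨z, hz⟩ := ih
    rcases le_total (mx l) (loc (pos l + st b) l + 1) with h | h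
    · exact ⟨pos l + st b, by rw [loc_self]; simp [mx, h]⟩
    · refine ⟨z, ?_⟩
      rw [mx, max_eq_left h, loc_ne, hz]
      rintro rfl
      omega

lemma mx_le_length (l : List Bool) : mx l ≤ l.length := by
  have : ∀ l z, loc z l ≤ l.length := by
    intro l z
    induction l with
    | nil => simp [loc]
    | cons b l ih => simp only [loc, List.length_cons]; split_ifs <;> omega
  obtain ⟨z, hz⟩ := exists_loc_eq_mx l
  rw [← hz]; exact this l z

lemma st_abs (b : Bool) : |st b| = 1 := by cases b <;> simp [st]

lemma pos_abs_le (l : List Bool) : |pos l| ≤ l.length := by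
  induction l with
  | nil => simp [pos]
  | cons b l ih =>
    simp only [pos, List.length_cons]
    have := abs_add_le (pos l) (st b)
    rw [st_abs] at this
    push_cast; omega

lemma loc_pos_range {z : ℤ} {l : List Bool} (h : 0 < loc z l) : |z| ≤ l.length := by
  induction l with
  | nil => simp [loc] at h
  | cons b l ih =>
    by_cases hz : pos l + st b = z
    · subst hz; exact pos_abs_le (b :: l)
    · rw [loc_ne hz] at h
      have := ih h
      simp only [List.length_cons]; push_cast; omega

lemma cnt_spec (k : ℕ) (hk : 0 < k) (l : List Bool) :
    {z | k ≤ loc z l}.Finite ∧ {z | k ≤ loc z l}.ncard = cnt k l := by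
  induction l with
  | nil =>
    have : {z : ℤ | k ≤ loc z []} = ∅ := by
      ext z; simp [loc]; omega
    rw [this]; simp [cnt]
  | cons b l ih =>
    obtain ⟨hf, hc⟩ := ih
    by_cases h : loc (pos l + st b) l + 1 = k
    · have : {z : ℤ | k ≤ loc z (b :: l)} = insert (pos l + st b) {z | k ≤ loc z l} := by
        ext z
        simp only [mem_setOf_eq, mem_insert_iff, loc_cons]
        split_ifs with hz
        · subst hz; simp [h]
        · simp [Ne.symm hz]
      rw [this]
      refine ⟨hf.insert _, ?_⟩
      rw [Set.ncard_insert_of_notMem _ hf, hc]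
      · simp [cnt, h]
      · simp only [mem_setOf_eq]; omega
    · have : {z : ℤ | k ≤ loc z (b :: l)} = {z | k ≤ loc z l} := by
        ext z
        simp only [mem_setOf_eq, loc_cons]
        split_ifs with hz
        · subst hz; omega
        · simp
      rw [this]
      exact ⟨hf, by simp [cnt, h, hc]⟩

lemma cnt_eq_zero {k : ℕ} {l : List Bool} (hk : mx l < k) : cnt k l = 0 := by
  rw [← (cnt_spec k (by omega) l).2]
  have : {z : ℤ | k ≤ loc z l} = ∅ := by
    ext z; have := loc_le_mx z l; simp; omega
  simp [this]

lemma loc_append (z : ℤ) (l l' : List Bool) :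
    pos (l' ++ l) = pos l + pos l' ∧ loc z (l' ++ l) = loc z l + loc (z - pos l) l' := by
  induction l' with
  | nil => simp [pos, loc]
  | cons b l' ih =>
    simp only [List.cons_append, pos, loc]
    rw [ih.1, ih.2]
    refine ⟨by ring, ?_⟩
    have : (pos l + pos l' + st b = z) ↔ (pos l' + st b = z - pos l) := by
      constructor <;> intro h <;> linarith
    simp only [this]; ring

section
variable {p q : ℝ}

lemma Ex_mono (hp : 0 ≤ p) (hq : 0 ≤ q) (n : ℕ) : ∀ {f g : List Bool → ℝ},
    (∀ l, l.length = n → f l ≤ g l) → Ex p q n f ≤ Ex p q n g := by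
  induction n with
  | zero => intro f g h; exact h [] rfl
  | succ n ih =>
    intro f g h
    simp only [Ex]
    apply ih
    intro l hl
    have h1 := h (true :: l) (by simp [hl])
    have h2 := h (false :: l) (by simp [hl])
    have := mul_le_mul_of_nonneg_left h1 hp
    have := mul_le_mul_of_nonneg_left h2 hq
    linarith

lemma Ex_add (n : ℕ) : ∀ (f g : List Bool → ℝ),
    Ex p q n (fun l => f l + g l) = Ex p q n f + Ex p q n g := by
  induction n with
  | zero => intro f g; rfl
  | succ n ih =>
    intro f g
    simp only [Ex]
    rw [← ih]; congr 1; ext l; ring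

lemma Ex_smul (n : ℕ) (c : ℝ) : ∀ (f : List Bool → ℝ),
    Ex p q n (fun l => c * f l) = c * Ex p q n f := by
  induction n with
  | zero => intro f; rfl
  | succ n ih =>
    intro f
    simp only [Ex]
    rw [← ih]; congr 1; ext l; ring

lemma Ex_const (hpq : p + q = 1) (n : ℕ) (c : ℝ) : Ex p q n (fun _ => c) = c := by
  induction n with
  | zero => rfl
  | succ n ih =>
    simp only [Ex]
    have : p * c + q * c = c := by rw [← add_mul, hpq, one_mul]
    rw [this, ih]

lemma Ex_sum {ι : Type*} (s : Finset ι) (n : ℕ) (f : ι → List Bool → ℝ) :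
    Ex p q n (fun l => ∑ i ∈ s, f i l) = ∑ i ∈ s, Ex p q n (f i) := by
  classical
  induction s using Finset.induction_on with
  | empty =>
    simp only [Finset.sum_empty]
    have := Ex_smul (p := p) (q := q) n 0 (fun _ => 0)
    simpa using this
  | insert i s hi ih =>
    simp only [Finset.sum_insert hi]
    rw [Ex_add, ih]

lemma Ex_append (m n : ℕ) : ∀ (f : List Bool → ℝ),
    Ex p q (m + n) f = Ex p q n (fun l => Ex p q m (fun l' => f (l' ++ l))) := by
  induction m with
  | zero => intro f; simp [Ex]
  | succ m ih =>
    intro f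
    rw [show m + 1 + n = (m + n) + 1 by ring]
    simp only [Ex]
    rw [ih]; rfl

lemma Ex_super (hp : 0 ≤ p) (hq : 0 ≤ q) (n : ℕ) {f : List Bool → ℝ}
    (h : ∀ l, p * f (true :: l) + q * f (false :: l) ≤ f l) : Ex p q n f ≤ f [] := by
  induction n with
  | zero => exact le_rfl
  | succ n ih =>
    exact le_trans (Ex_mono hp hq n (fun l _ => h l)) ih

open Classical in
/-- probability -/
noncomputable def Pr (p q : ℝ) (n : ℕ) (A : List Bool → Prop) : ℝ :=
  Ex p q n (fun l => if A l then 1 else 0)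

lemma Pr_le_Ex (hp : 0 ≤ p) (hq : 0 ≤ q) (n : ℕ) {A : List Bool → Prop} {f : List Bool → ℝ}
    (h0 : ∀ l, 0 ≤ f l) (h : ∀ l, l.length = n → A l → 1 ≤ f l) : Pr p q n A ≤ Ex p q n f := by
  classical
  apply Ex_mono hp hq
  intro l hl
  split_ifs with hA
  · exact h l hl hA
  · exact h0 l

lemma Pr_nonneg (hp : 0 ≤ p) (hq : 0 ≤ q) (hpq : p + q = 1) (n : ℕ) (A : List Bool → Prop) :
    0 ≤ Pr p q n A := by
  classical
  rw [← Ex_const hpq n 0]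
  apply Ex_mono hp hq
  intro l _
  split_ifs <;> norm_num

/-- some time in the history lies in `A` -/
def Hit (A : List Bool → Prop) : List Bool → Prop
  | [] => A []
  | b :: l => Hit A l ∨ A (b :: l)

lemma Hit_self {A : List Bool → Prop} {l : List Bool} (h : A l) : Hit A l := by
  cases l with
  | nil => exact h
  | cons b l => exact Or.inr h

lemma Pr_hit_le (hp : 0 ≤ p) (hq : 0 ≤ q) (hpq : p + q = 1) (n : ℕ) {A : List Bool → Prop}
    {f : List Bool → ℝ} (h0 : ∀ l, 0 ≤ f l) (h1 : ∀ l, A l → 1 ≤ f l)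
    (h : ∀ l, p * f (true :: l) + q * f (false :: l) ≤ f l) : Pr p q n (Hit A) ≤ f [] := by
  classical
  set g : List Bool → ℝ := fun l => if Hit A l then 1 else f l with hg
  have hle : ∀ l b, ¬ Hit A l → g (b :: l) ≤ f (b :: l) := by
    intro l b hl
    simp only [hg]
    split_ifs with hh
    · exact h1 _ (hh.resolve_left hl)
    · exact le_rfl
  have hgs : ∀ l, p * g (true :: l) + q * g (false :: l) ≤ g l := by
    intro l
    by_cases hl : Hit A l
    · simp only [hg, hl, Hit, true_or, if_true]; linarith
    · have e : g l = f l := by simp [hg, hl]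
      rw [e]
      refine le_trans ?_ (h l)
      have a1 := mul_le_mul_of_nonneg_left (hle l true hl) hp
      have a2 := mul_le_mul_of_nonneg_left (hle l false hl) hq
      linarith
  have hge : g [] ≤ f [] := by
    simp only [hg]
    split_ifs with hh
    · exact h1 _ hh
    · exact le_rfl
  refine le_trans ?_ (le_trans (Ex_super hp hq n hgs) hge)
  apply Pr_le_Ex hp hq
  · intro l; simp only [hg]; split_ifs
    · norm_num
    · exact h0 l
  · intro l _ hl; simp [hg, hl]

end

end FavW


namespace FavW

/-- hitting probability of zero -/
noncomputable def uu (r : ℝ) (x : ℤ) : ℝ := if x ≤ 0 then 1 else r ^ x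

section
variable {p q : ℝ}

lemma p_pos (hq : q < 1/2) (hpq : p + q = 1) : 0 < p := by linarith

lemma r_pos (hq0 : 0 < q) (hq : q < 1/2) (hpq : p + q = 1) : 0 < q / p :=
  div_pos hq0 (p_pos hq hpq)

lemma r_lt (hq0 : 0 < q) (hq : q < 1/2) (hpq : p + q = 1) : q / p < 2 * q := by
  rw [div_lt_iff₀ (p_pos hq hpq)]; nlinarith

lemma r_lt_one (hq : q < 1/2) (hpq : p + q = 1) : q / p < 1 := by
  rw [div_lt_one (p_pos hq hpq)]; linarith

lemma harm (hq0 : 0 < q) (hq : q < 1/2) (hpq : p + q = 1) (x : ℤ) :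
    p * (q / p) ^ (x + 1) + q * (q / p) ^ (x - 1) = (q / p) ^ x := by
  have hp := p_pos hq hpq
  have hr := r_pos hq0 hq hpq
  rw [zpow_add_one₀ hr.ne', zpow_sub_one₀ hr.ne']
  field_simp
  linear_combination hpq

lemma uu_zero (r : ℝ) : uu r 0 = 1 := by simp [uu]

lemma uu_pos {r : ℝ} (hr : 0 < r) (x : ℤ) : 0 < uu r x := by
  unfold uu; split_ifs
  · norm_num
  · positivity

lemma uu_le_one {r : ℝ} (hr : 0 < r) (hr1 : r ≤ 1) (x : ℤ) : uu r x ≤ 1 := by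
  unfold uu; split_ifs with h
  · norm_num
  · obtain ⟨n, rfl⟩ := Int.eq_ofNat_of_zero_le (by omega : 0 ≤ x)
    rw [zpow_natCast]; exact pow_le_one₀ hr.le hr1

lemma uu_harm (hq0 : 0 < q) (hq : q < 1/2) (hpq : p + q = 1) {x : ℤ} (hx : x ≠ 0) :
    p * uu (q / p) (x + 1) + q * uu (q / p) (x - 1) = uu (q / p) x := by
  have hp := p_pos hq hpq
  have hr := r_pos hq0 hq hpq
  unfold uu
  rcases lt_or_gt_of_ne hx with h | h
  · rw [if_pos (by omega), if_pos (by omega), if_pos (by omega)]; linarith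
  · rw [if_neg (by omega), if_neg (by omega : ¬ x ≤ 0)]
    split_ifs with h1
    · have : x = 1 := by omega
      subst this
      have := harm hq0 hq hpq 1
      simpa using this
    · exact harm hq0 hq hpq x

lemma uu_harm_zero (hq : q < 1/2) (hpq : p + q = 1) :
    p * uu (q / p) (0 + 1) + q * uu (q / p) (0 - 1) = 2 * q := by
  have hp := p_pos hq hpq
  simp [uu]
  field_simp
  ring

lemma uu_super (hq0 : 0 < q) (hq : q < 1/2) (hpq : p + q = 1) (x : ℤ) :
    p * uu (q / p) (x + 1) + q * uu (q / p) (x - 1) ≤ uu (q / p) x := by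
  by_cases hx : x = 0
  · subst hx; rw [uu_harm_zero hq hpq, uu_zero]; linarith
  · exact (uu_harm hq0 hq hpq hx).le

lemma uu_le_zpow (hq0 : 0 < q) (hq : q < 1/2) (hpq : p + q = 1) (x : ℤ) :
    uu (q / p) x ≤ (2 * q) ^ x := by
  unfold uu; split_ifs with h
  · obtain ⟨n, rfl⟩ : ∃ n : ℕ, x = -(n : ℤ) := ⟨x.natAbs, by omega⟩
    rw [zpow_neg, zpow_natCast]
    exact (one_le_inv₀ (by positivity)).2 (pow_le_one₀ (by linarith) (by linarith))
  · obtain ⟨n, rfl⟩ := Int.eq_ofNat_of_zero_le (by omega : 0 ≤ x)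
    rw [zpow_natCast, zpow_natCast]
    exact pow_le_pow_left₀ (r_pos hq0 hq hpq).le (r_lt hq0 hq hpq).le _

/-- decay rate -/
noncomputable def lam (q : ℝ) : ℝ := 2 * (1 - q) * q + 1 / 2

lemma lam_pos (hq0 : 0 < q) (hq : q < 1/2) : 0 < lam q := by unfold lam; nlinarith

lemma lam_lt_one (hq : q < 1/2) : lam q < 1 := by
  unfold lam; nlinarith [sq_pos_of_pos (by linarith : 0 < 1/2 - q)]

lemma harm2 (hq0 : 0 < q) (hpq : p + q = 1) (x : ℤ) :
    p * (2 * q) ^ (x + 1) + q * (2 * q) ^ (x - 1) = lam q * (2 * q) ^ x := by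
  have h : (2 * q) ≠ 0 := by positivity
  rw [zpow_add_one₀ h, zpow_sub_one₀ h]
  obtain rfl : p = 1 - q := by linarith
  unfold lam
  field_simp

lemma Ex_sub (hp : 0 ≤ p) (hq : 0 ≤ q) (n : ℕ) {f : List Bool → ℝ}
    (h : ∀ l, f l ≤ p * f (true :: l) + q * f (false :: l)) : f [] ≤ Ex p q n f := by
  induction n with
  | zero => exact le_rfl
  | succ n ih =>
    exact le_trans ih (Ex_mono hp hq n (fun l _ => h l))

lemma return_lower (hq0 : 0 < q) (hq : q < 1/2) (hpq : p + q = 1) (m n : ℕ) (hm : 0 < m) :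
    (2 * q) ^ m - lam q ^ n ≤ Pr p q n (fun l => m ≤ loc 0 l) := by
  classical
  have hp := p_pos hq hpq
  have hl := lam_pos hq0 hq
  have ha : 0 < 2 * q := by positivity
  have ha1 : 2 * q ≤ 1 := by linarith
  have hr := r_pos hq0 hq hpq
  set f : List Bool → ℝ := fun l => if m ≤ loc 0 l then 1 else
    (if pos l = 0 then (2 * q) ^ (m - loc 0 l) else
      (2 * q) ^ (m - loc 0 l - 1) * uu (q / p) (pos l))
      - lam q ^ n * (lam q)⁻¹ ^ l.length * (2 * q) ^ (pos l) with hf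
  have h0 : f [] = (2 * q) ^ m - lam q ^ n := by
    simp [hf, loc, pos, hm.ne']
  rw [← h0]
  have key : ∀ (l : List Bool) (b : Bool), ¬ m ≤ loc 0 l →
      (2 * q) ^ (m - loc 0 l - 1) * uu (q / p) (pos l + st b)
      - lam q ^ n * (lam q)⁻¹ ^ (l.length + 1) * (2 * q) ^ (pos l + st b) ≤ f (b :: l) := by
    intro l b hlm
    have herr : 0 ≤ lam q ^ n * (lam q)⁻¹ ^ (l.length + 1) * (2 * q) ^ (pos l + st b) := by
      positivity
    have hb : f (b :: l) = if m ≤ loc 0 (b :: l) then 1 else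
      (if pos l + st b = 0 then (2 * q) ^ (m - loc 0 (b :: l)) else
      (2 * q) ^ (m - loc 0 (b :: l) - 1) * uu (q / p) (pos l + st b))
      - lam q ^ n * (lam q)⁻¹ ^ (l.length + 1) * (2 * q) ^ (pos l + st b) := rfl
    rw [hb]
    by_cases hy : pos l + st b = 0
    · have e : loc 0 (b :: l) = loc 0 l + 1 := by rw [← hy, loc_self]
      rw [if_pos hy, e, hy, uu_zero]
      rw [hy] at herr
      split_ifs with hm2
      · have : (2 * q) ^ (m - loc 0 l - 1) ≤ 1 := pow_le_one₀ ha.le ha1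
        linarith
      · rw [show m - (loc 0 l + 1) = m - loc 0 l - 1 by omega]; linarith
    · rw [if_neg hy, loc_ne hy, if_neg hlm]
  refine le_trans (Ex_sub hp.le hq0.le n (f := f) ?_) ?_
  · intro l
    by_cases hlm : m ≤ loc 0 l
    · have e : ∀ b, f (b :: l) = 1 := fun b => by
        simp only [hf]; rw [if_pos (le_trans hlm (loc_le_cons _ _ _))]
      rw [e, e]; simp only [hf]; rw [if_pos hlm]; linarith
    · have k1 := mul_le_mul_of_nonneg_left (key l true hlm) hp.le
      have k2 := mul_le_mul_of_nonneg_left (key l false hlm) hq0.le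
      refine le_trans ?_ (add_le_add k1 k2)
      have s1 : st true = 1 := rfl
      have s2 : st false = -1 := rfl
      rw [s1, s2, ← sub_eq_add_neg]
      have hh := harm2 hq0 hpq (pos l)
      simp only [hf]; rw [if_neg hlm]
      have e1 : lam q ^ n * (lam q)⁻¹ ^ l.length * (2 * q) ^ pos l =
          lam q ^ n * (lam q)⁻¹ ^ (l.length + 1) * (lam q * (2 * q) ^ pos l) := by
        rw [pow_succ]; field_simp
      rw [e1, ← hh]
      by_cases hx : pos l = 0
      · rw [if_pos hx, hx]
        have := uu_harm_zero hq hpq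
        rw [show m - loc 0 l = (m - loc 0 l - 1) + 1 by omega, pow_succ]
        simp only [Nat.add_sub_cancel]
        rw [← this]
        apply le_of_eq; ring
      · rw [if_neg hx, ← uu_harm hq0 hq hpq hx]
        apply le_of_eq; ring
  · apply Ex_mono hp.le hq0.le
    intro l hln
    simp only [hf]
    split_ifs with h1 h2
    · exact le_rfl
    · rw [hln, h2, inv_pow, mul_inv_cancel₀ (by positivity)]
      have : (2 * q) ^ (m - loc 0 l) ≤ 1 := pow_le_one₀ ha.le ha1
      simpa using this
    · rw [hln, inv_pow, mul_inv_cancel₀ (by positivity), one_mul, sub_nonpos]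
      have a1 : (2 * q) ^ (m - loc 0 l - 1) ≤ 1 := pow_le_one₀ ha.le ha1
      have a2 := uu_le_zpow hq0 hq hpq (pos l)
      have a3 := uu_pos hr (pos l)
      nlinarith

lemma Pr_not (hpq : p + q = 1) (n : ℕ) (A : List Bool → Prop) :
    Pr p q n (fun l => ¬ A l) = 1 - Pr p q n A := by
  classical
  unfold Pr
  have h := Ex_add (p := p) (q := q) n (fun l => if A l then 1 else 0)
    (fun l => if ¬ A l then 1 else 0)
  have h2 : (fun l : List Bool => ((if A l then 1 else 0 : ℝ) + if ¬ A l then 1 else 0))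
      = fun _ => 1 := by
    ext l; by_cases hA : A l <;> simp [hA]
  rw [h2, Ex_const hpq] at h
  have e : ∀ (x y z : ℝ), 1 = x + y → y = z → z = 1 - x := by intros; linarith
  refine e _ _ _ h ?_
  congr 1
  ext l
  by_cases hA : A l <;> simp [hA]

lemma mx_append_le (l l' : List Bool) : mx l ≤ mx (l' ++ l) ∧ loc 0 l' ≤ mx (l' ++ l) := by
  constructor
  · obtain ⟨z, hz⟩ := exists_loc_eq_mx l
    have := loc_le_mx z (l' ++ l)
    have h := (loc_append z l l').2
    omega
  · have := loc_le_mx (pos l) (l' ++ l)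
    have h := (loc_append (pos l) l l').2
    rw [sub_self] at h
    omega

lemma block_bound (hq0 : 0 < q) (hq : q < 1/2) (hpq : p + q = 1) (k B M : ℕ) :
    Pr p q (M * B) (fun l => mx l ≤ k) ≤ (1 - Pr p q B (fun l => k + 1 ≤ loc 0 l)) ^ M := by
  classical
  have hp := p_pos hq hpq
  rw [← Pr_not hpq]
  induction M with
  | zero =>
    simp only [Nat.zero_mul, pow_zero, Pr, Ex]
    split_ifs <;> norm_num
  | succ M ih =>
    rw [pow_succ, show (M + 1) * B = B + M * B by ring]
    have hnn := Pr_nonneg hp.le hq0.le hpq B (fun l => ¬ k + 1 ≤ loc 0 l)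
    refine le_trans ?_ (mul_le_mul_of_nonneg_right ih hnn)
    unfold Pr at hnn ⊢
    rw [mul_comm (Ex p q (M * B) _), Ex_append, ← Ex_smul]
    apply Ex_mono hp.le hq0.le
    intro l _
    by_cases hl : mx l ≤ k
    · rw [if_pos hl, mul_one]
      apply Ex_mono hp.le hq0.le
      intro l' _
      have := (mx_append_le l l').2
      split_ifs with g1 g2
      · exact le_rfl
      · exact absurd (fun h => absurd (le_trans h this) (by have : mx (l' ++ l) ≤ k := g1; omega)) g2
      · norm_num
      · exact le_rfl
    · rw [if_neg hl, mul_zero]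
      refine le_of_eq ?_
      refine Eq.trans ?_ (Ex_const hpq B 0)
      congr 1
      ext l'
      refine if_neg ?_
      have := (mx_append_le l l').1
      exact fun h => hl (this.trans h)

/-- There is a horizon `N k`, at most exponential with prefactor, by which level `k` is passed. -/
lemma horizon (hq0 : 0 < q) (hq : q < 1/2) (hpq : p + q = 1) :
    ∃ (N : ℕ → ℕ) (C : ℝ), 0 < C ∧ (∀ k, (N k : ℝ) ≤ C * (k + 1) ^ 2 * ((2 * q)⁻¹) ^ k) ∧
      ∀ k, Pr p q (N k) (fun l => mx l ≤ k) ≤ Real.exp (-k) := by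
  have hp := p_pos hq hpq
  have ha : 0 < 2 * q := by positivity
  have ha1 : 2 * q ≤ 1 := by linarith
  obtain ⟨D, hD⟩ := exists_pow_lt_of_lt_one (by positivity : 0 < 2 * q / 2) (lam_lt_one hq)
  refine ⟨fun k => ⌈2 * (k : ℝ) * ((2 * q)⁻¹) ^ (k + 1)⌉₊ * (D * (k + 1)),
    (2 * (2 * q)⁻¹ + 1) * (D + 1), by positivity, ?_, ?_⟩
  · intro k
    push_cast
    have h1 := (Nat.ceil_lt_add_one
      (by positivity : 0 ≤ 2 * (k : ℝ) * ((2 * q)⁻¹) ^ (k + 1))).le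
    have h2 : (1 : ℝ) ≤ ((2 * q)⁻¹) ^ k := one_le_pow₀ ((one_le_inv₀ ha).2 ha1)
    have h3 : 2 * (k : ℝ) * ((2 * q)⁻¹) ^ (k + 1) + 1 ≤
        (2 * (2 * q)⁻¹ + 1) * (k + 1) * ((2 * q)⁻¹) ^ k := by
      rw [pow_succ]
      have : 0 < (2 * q)⁻¹ := by positivity
      have hk : (0:ℝ) ≤ k := by positivity
      have : 0 ≤ (2 * q)⁻¹ * ((2 * q)⁻¹) ^ k := by positivity
      have : 0 ≤ (k:ℝ) * ((2 * q)⁻¹) ^ k := by positivity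
      nlinarith
    calc _ ≤ ((2 * (2 * q)⁻¹ + 1) * (k + 1) * ((2 * q)⁻¹) ^ k) * ((D + 1) * (k + 1)) := by
            gcongr
            · exact h1.trans h3
            · linarith
      _ = _ := by ring
  · intro k
    refine le_trans (block_bound hq0 hq hpq k _ _) ?_
    have h1 := return_lower hq0 hq hpq (k + 1) (D * (k + 1)) (by omega)
    have h2 : lam q ^ (D * (k + 1)) ≤ (2 * q) ^ (k + 1) / 2 := by
      rw [pow_mul]
      calc _ ≤ (2 * q / 2) ^ (k + 1) := pow_le_pow_left₀ (pow_pos (lam_pos hq0 hq) _).le hD.le _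
        _ = (2 * q) ^ (k + 1) / 2 ^ (k + 1) := by rw [div_pow]
        _ ≤ _ := by
          gcongr
          exact le_self_pow₀ (by norm_num) (by omega)
    set ρ := Pr p q (D * (k + 1)) (fun l => k + 1 ≤ loc 0 l)
    set M := ⌈2 * (k : ℝ) * ((2 * q)⁻¹) ^ (k + 1)⌉₊
    have hρ : (2 * q) ^ (k + 1) / 2 ≤ ρ := by linarith
    have hρ1 : 0 ≤ 1 - ρ := by
      rw [← Pr_not hpq]; exact Pr_nonneg hp.le hq0.le hpq _ _
    have hM : 2 * (k : ℝ) * ((2 * q)⁻¹) ^ (k + 1) ≤ M := Nat.le_ceil _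
    calc (1 - ρ) ^ M ≤ (Real.exp (-ρ)) ^ M := by
          gcongr
          have := Real.add_one_le_exp (-ρ); linarith
      _ = Real.exp (-(M * ρ)) := by rw [← Real.exp_nat_mul]; congr 1; ring
      _ ≤ _ := by
        apply Real.exp_le_exp.2
        have : (k : ℝ) = (2 * (k : ℝ) * ((2 * q)⁻¹) ^ (k + 1)) * ((2 * q) ^ (k + 1) / 2) := by
          rw [inv_pow]; field_simp
        have h5 : (2 * (k : ℝ) * ((2 * q)⁻¹) ^ (k + 1)) * ((2 * q) ^ (k + 1) / 2) ≤ M * ρ := by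
          gcongr
        linarith

end
end FavW


namespace FavW

section
variable {p q : ℝ}

/-- pair potential -/
noncomputable def gg (r ε : ℝ) (d : ℤ) (x : ℤ) : ℝ := uu r x + uu r (x - d) + ε

lemma uu_le_r {r : ℝ} (hr : 0 < r) (hr1 : r ≤ 1) {d : ℤ} (hd : 0 < d) : uu r d ≤ r := by
  unfold uu
  rw [if_neg (by omega)]
  obtain ⟨n, rfl⟩ : ∃ n : ℕ, d = (n : ℤ) + 1 := ⟨(d - 1).toNat, by omega⟩
  rw [zpow_add_one₀ hr.ne', zpow_natCast]
  have := pow_le_one₀ hr.le hr1 (n := n)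
  nlinarith

lemma pair_super (hq0 : 0 < q) (hq : q < 1/2) (hpq : p + q = 1) {ε : ℝ} (hε : 0 < ε)
    {s₁ s₂ : ℝ} (h1 : 1 ≤ s₁) (h2 : 1 ≤ s₂) (e1 : s₁ * (1 + 2 * q + ε) ≤ 2 + ε)
    (e2 : s₂ * (q / p + 2 * q + ε) ≤ 1 + q / p + ε) (e3 : s₂ * (2 * q + ε) ≤ 1 + ε)
    (z d : ℤ) (hd : 0 < d) (n : ℕ) :
    Ex p q n (fun l => s₁ ^ loc z l * s₂ ^ loc (z + d) l) ≤ (2 + ε) / ε := by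
  have hp := p_pos hq hpq
  have hr := r_pos hq0 hq hpq
  have hr1 := r_lt_one hq hpq
  set r := q / p with hrdef
  set G : ℤ → ℝ := fun x => p * gg r ε d (x + 1) + q * gg r ε d (x - 1) with hG
  have hgpos : ∀ x, ε ≤ gg r ε d x := fun x => by
    have := uu_pos hr x; have := uu_pos hr (x - d); unfold gg; linarith
  have hgle : ∀ x, gg r ε d x ≤ 2 + ε := fun x => by
    have := uu_le_one hr hr1.le x; have := uu_le_one hr hr1.le (x - d); unfold gg; linarith
  have hGpos : ∀ x, ε ≤ G x := fun x => by
    have := hgpos (x + 1); have := hgpos (x - 1); simp only [hG]; nlinarith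
  have hGle : ∀ x, G x ≤ 2 + ε := fun x => by
    have := hgle (x + 1); have := hgle (x - 1); simp only [hG]; nlinarith
  have hGeq : ∀ x, G x = (p * uu r (x + 1) + q * uu r (x - 1)) +
      (p * uu r ((x - d) + 1) + q * uu r ((x - d) - 1)) + ε := fun x => by
    simp only [hG, gg]
    rw [show x + 1 - d = x - d + 1 by ring, show x - 1 - d = x - d - 1 by ring]
    linear_combination ε * hpq
  have hGle' : ∀ x, G x ≤ gg r ε d x := fun x => by
    rw [hGeq]; unfold gg
    have := uu_super hq0 hq hpq x
    have := uu_super hq0 hq hpq (x - d)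
    linarith
  have hG0 : s₁ * G 0 ≤ gg r ε d 0 := by
    rw [hGeq, uu_harm_zero hq hpq, uu_harm hq0 hq hpq (by omega : (0 - d) ≠ 0)]
    have : uu r (0 - d) = 1 := by unfold uu; rw [if_pos (by omega)]
    unfold gg; rw [← hrdef, this, uu_zero]; linarith
  have hGd : s₂ * G d ≤ gg r ε d d := by
    rw [hGeq, sub_self, uu_harm_zero hq hpq, uu_harm hq0 hq hpq (by omega : d ≠ 0)]
    have := uu_le_r hr hr1.le hd
    have := uu_pos hr d
    unfold gg; rw [← hrdef, sub_self, uu_zero]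
    nlinarith
  set V : List Bool → ℝ := fun l => s₁ ^ loc z l * s₂ ^ loc (z + d) l * G (pos l - z) with hV
  have step : ∀ l b, V (b :: l) ≤ s₁ ^ loc z l * s₂ ^ loc (z + d) l * gg r ε d (pos l + st b - z) := by
    intro l b
    simp only [hV, pos]
    have hh : 0 ≤ s₁ ^ loc z l * s₂ ^ loc (z + d) l := by positivity
    by_cases hz : pos l + st b = z
    · have a1 : loc z (b :: l) = loc z l + 1 := by rw [← hz, loc_self]
      have a2 : loc (z + d) (b :: l) = loc (z + d) l := loc_ne (by omega)
      rw [a1, a2, hz, sub_self, pow_succ]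
      nlinarith [mul_le_mul_of_nonneg_left hG0 hh]
    · by_cases hz2 : pos l + st b = z + d
      · have a1 : loc z (b :: l) = loc z l := loc_ne hz
        have a2 : loc (z + d) (b :: l) = loc (z + d) l + 1 := by rw [← hz2, loc_self]
        rw [a1, a2, hz2, show z + d - z = d by ring, pow_succ]
        nlinarith [mul_le_mul_of_nonneg_left hGd hh]
      · rw [loc_ne hz, loc_ne hz2]
        exact mul_le_mul_of_nonneg_left (hGle' _) hh
  have hsup : Ex p q n V ≤ V [] := by
    apply Ex_super hp.le hq0.le
    intro l
    have k1 := mul_le_mul_of_nonneg_left (step l true) hp.le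
    have k2 := mul_le_mul_of_nonneg_left (step l false) hq0.le
    refine le_trans (add_le_add k1 k2) (le_of_eq ?_)
    have s1 : st true = 1 := rfl
    have s2 : st false = -1 := rfl
    rw [s1, s2]
    simp only [hV, hG]
    rw [show pos l + 1 - z = pos l - z + 1 by ring, show pos l + -1 - z = pos l - z - 1 by ring]
    ring
  rw [le_div_iff₀ hε, mul_comm, ← Ex_smul]
  refine le_trans (Ex_mono hp.le hq0.le n ?_) (le_trans hsup ?_)
  · intro l _
    simp only [hV]
    have hh : 0 ≤ s₁ ^ loc z l * s₂ ^ loc (z + d) l := by positivity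
    rw [mul_comm]
    exact mul_le_mul_of_nonneg_left (hGpos _) hh
  · simp only [hV, loc, pow_zero, one_mul]; exact hGle _

lemma Pr_mono (hp : 0 ≤ p) (hq : 0 ≤ q) (n : ℕ) {A B : List Bool → Prop}
    (h : ∀ l, l.length = n → A l → B l) : Pr p q n A ≤ Pr p q n B := by
  classical
  apply Ex_mono hp hq
  intro l hl
  by_cases hA : A l
  · rw [if_pos hA, if_pos (h l hl hA)]
  · rw [if_neg hA]; split_ifs <;> norm_num

lemma Pr_markov (hp : 0 ≤ p) (hq : 0 ≤ q) (n : ℕ) {A : List Bool → Prop} {f : List Bool → ℝ}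
    {c D : ℝ} (hc : 0 < c) (h0 : ∀ l, 0 ≤ f l) (hf : Ex p q n f ≤ D)
    (h : ∀ l, A l → c ≤ f l) : Pr p q n A ≤ D * c⁻¹ := by
  have : Pr p q n A ≤ Ex p q n (fun l => c⁻¹ * f l) := by
    apply Pr_le_Ex hp hq
    · intro l; have := h0 l; positivity
    · intro l _ hA
      rw [← inv_mul_cancel₀ hc.ne']
      exact mul_le_mul_of_nonneg_left (h l hA) (by positivity)
  rw [Ex_smul] at this
  refine this.trans ?_
  rw [mul_comm]
  exact mul_le_mul_of_nonneg_right hf (by positivity)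

lemma pair_bound (hq0 : 0 < q) (hq : q < 1/2) (hpq : p + q = 1) :
    ∃ b C s : ℝ, 0 < b ∧ b < 2 * q ∧ 0 < C ∧ 1 < s ∧
      (∀ (z d : ℤ) (n k : ℕ), 0 < d →
        Pr p q n (fun l => k ≤ loc z l ∧ k ≤ loc (z + d) l) ≤ C * b ^ k) ∧
      (∀ (z : ℤ) (n k : ℕ), Pr p q n (fun l => k ≤ loc z l) ≤ C * (s⁻¹) ^ k) := by
  have hp := p_pos hq hpq
  have hr := r_pos hq0 hq hpq
  have hr1 := r_lt_one hq hpq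
  have hra := r_lt hq0 hq hpq
  set ε := (2 * q - q / p) / 4 with hεd
  have hε : 0 < ε := by rw [hεd]; linarith
  set r := q / p
  set s₁ := (2 + ε) / (1 + 2 * q + ε) with hs1
  set s₂ := (1 + r + ε) / (r + 2 * q + ε) with hs2
  have d1 : 0 < 1 + 2 * q + ε := by linarith
  have d2 : 0 < r + 2 * q + ε := by linarith
  have h1 : 1 < s₁ := by rw [hs1, one_lt_div d1]; linarith
  have h2 : 1 < s₂ := by rw [hs2, one_lt_div d2]; linarith
  have e1 : s₁ * (1 + 2 * q + ε) = 2 + ε := div_mul_cancel₀ _ d1.ne'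
  have e2 : s₂ * (r + 2 * q + ε) = 1 + r + ε := div_mul_cancel₀ _ d2.ne'
  have e3 : s₂ * (2 * q + ε) ≤ 1 + ε := by nlinarith
  have key : ∀ (z d : ℤ) (n : ℕ), 0 < d →
      Ex p q n (fun l => s₁ ^ loc z l * s₂ ^ loc (z + d) l) ≤ (2 + ε) / ε := fun z d n hd =>
    pair_super hq0 hq hpq hε h1.le h2.le e1.le e2.le e3 z d hd n
  refine ⟨(s₁ * s₂)⁻¹, (2 + ε) / ε, s₁, by positivity, ?_, by positivity, h1, ?_, ?_⟩
  · rw [inv_lt_iff_one_lt_mul₀ (by positivity)]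
    have : s₁ * s₂ = ((2 + ε) * (1 + r + ε)) / ((1 + 2 * q + ε) * (r + 2 * q + ε)) := by
      rw [hs1, hs2]; field_simp
    rw [this, mul_div_assoc', one_lt_div (by positivity), ← sub_pos]
    have : 2 * q * ((2 + ε) * (1 + r + ε)) - (1 + 2 * q + ε) * (r + 2 * q + ε) =
      (1 - 2 * q) * ((2 * q - r) - ε * (1 + r) - ε * ε) := by ring
    rw [this]
    apply mul_pos (by linarith)
    have : 2 * q - r = 4 * ε := by rw [hεd]; ring
    rw [this]
    have : ε < 1 := by rw [hεd]; linarith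
    nlinarith
  · intro z d n k hd
    rw [inv_pow]
    refine Pr_markov hp.le hq0.le n (by positivity) (fun l => by positivity) (key z d n hd) ?_
    rintro l ⟨a1, a2⟩
    rw [mul_pow]
    gcongr
    · exact h1.le
    · exact h2.le
  · intro z n k
    rw [inv_pow]
    refine Pr_markov hp.le hq0.le n (by positivity) (fun l => by positivity)
      (key z 1 n one_pos) ?_
    intro l a1
    have : 1 ≤ s₂ ^ loc (z + 1) l := one_le_pow₀ h2.le
    calc s₁ ^ k ≤ s₁ ^ loc z l := pow_le_pow_right₀ h1.le a1
      _ ≤ _ := le_mul_of_one_le_right (by positivity) this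

lemma Pr_union (hp : 0 ≤ p) (hq : 0 ≤ q) (n : ℕ) {ι : Type*} (s : Finset ι)
    (A : ι → List Bool → Prop) {B : List Bool → Prop}
    (h : ∀ l, l.length = n → B l → ∃ i ∈ s, A i l) :
    Pr p q n B ≤ ∑ i ∈ s, Pr p q n (A i) := by
  classical
  unfold Pr
  rw [← Ex_sum]
  apply Ex_mono hp hq
  intro l hl
  have nn : ∀ i ∈ s, (0 : ℝ) ≤ if A i l then 1 else 0 := fun i _ => by split_ifs <;> norm_num
  split_ifs with hB
  · obtain ⟨i, hi, hA⟩ := h l hl hB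
    refine le_trans ?_ (Finset.single_le_sum nn hi)
    rw [if_pos hA]
  · exact Finset.sum_nonneg nn

/-- two close sites are at level `k` -/
def Bad (R k : ℕ) (l : List Bool) : Prop :=
  ∃ (z d : ℤ), 0 < d ∧ d < R ∧ k ≤ loc z l ∧ k ≤ loc (z + d) l

lemma Bad_cons {R k : ℕ} {l : List Bool} (b : Bool) (h : Bad R k l) : Bad R k (b :: l) := by
  obtain ⟨z, d, h1, h2, h3, h4⟩ := h
  exact ⟨z, d, h1, h2, h3.trans (loc_le_cons _ _ _), h4.trans (loc_le_cons _ _ _)⟩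

lemma bad_prob (hp : 0 ≤ p) (hq : 0 ≤ q) {C b : ℝ}
    (hC : ∀ (z d : ℤ) (n k : ℕ), 0 < d →
        Pr p q n (fun l => k ≤ loc z l ∧ k ≤ loc (z + d) l) ≤ C * b ^ k)
    (R k n : ℕ) (hk : 0 < k) :
    Pr p q n (Bad R k) ≤ (2 * n + 1) * R * (C * b ^ k) := by
  refine (Pr_union hp hq n (Finset.Icc (-(n:ℤ)) n ×ˢ Finset.range R)
    (fun i l => 0 < (i.2 : ℤ) ∧ k ≤ loc i.1 l ∧ k ≤ loc (i.1 + (i.2 : ℤ)) l) ?_).trans ?_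
  · rintro l hl ⟨z, d, h1, h2, h3, h4⟩
    have := loc_pos_range (lt_of_lt_of_le hk h3)
    rw [hl, abs_le] at this
    refine ⟨(z, d.toNat), ?_, ?_, h3, ?_⟩
    · simp only [Finset.mem_product, Finset.mem_Icc, Finset.mem_range]
      exact ⟨this, by omega⟩
    · simp; omega
    · have : (((z, d.toNat) : ℤ × ℕ).2 : ℤ) = d := by simp; omega
      rw [this]; exact h4
  · have hnn : 0 ≤ C * b ^ k := by
      refine le_trans ?_ (hC 0 1 0 k one_pos)
      unfold Pr; simp only [Ex]; split_ifs <;> norm_num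
    calc _ ≤ ∑ i ∈ Finset.Icc (-(n:ℤ)) n ×ˢ Finset.range R, C * b ^ k := by
          apply Finset.sum_le_sum
          rintro ⟨z, d⟩ _
          by_cases hd : 0 < (d : ℤ)
          · exact (Pr_mono hp hq n (fun l _ h => h.2)).trans (hC z d n k hd)
          · refine le_trans (le_of_eq ?_) hnn
            unfold Pr
            simp only [hd, false_and, if_false]
            simpa using Ex_smul (p := p) (q := q) n 0 (fun _ => 0)
      _ = _ := by
        rw [Finset.sum_const, Finset.card_product, Int.card_Icc, Finset.card_range, nsmul_eq_mul]
        rw [show ((n : ℤ) + 1 - -(n:ℤ)).toNat = 2 * n + 1 by omega]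
        push_cast; ring

lemma mx_prob (hp : 0 ≤ p) (hq : 0 ≤ q) {C s : ℝ}
    (hC : ∀ (z : ℤ) (n k : ℕ), Pr p q n (fun l => k ≤ loc z l) ≤ C * (s⁻¹) ^ k)
    (k n : ℕ) (hk : 0 < k) :
    Pr p q n (fun l => k ≤ mx l) ≤ (2 * n + 1) * (C * (s⁻¹) ^ k) := by
  refine (Pr_union hp hq n (Finset.Icc (-(n:ℤ)) n) (fun z l => k ≤ loc z l) ?_).trans ?_
  · intro l hl h
    obtain ⟨z, hz⟩ := exists_loc_eq_mx l
    have h3 : k ≤ loc z l := by omega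
    have := loc_pos_range (lt_of_lt_of_le hk h3)
    rw [hl, abs_le] at this
    exact ⟨z, Finset.mem_Icc.2 this, h3⟩
  · calc _ ≤ ∑ i ∈ Finset.Icc (-(n:ℤ)) n, C * (s⁻¹) ^ k :=
          Finset.sum_le_sum (fun z _ => hC z n k)
      _ = _ := by
        rw [Finset.sum_const, Int.card_Icc, nsmul_eq_mul]
        rw [show ((n : ℤ) + 1 - -(n:ℤ)).toNat = 2 * n + 1 by omega]
        push_cast; ring

end
end FavW


namespace FavW

/-- the last site that reached level `k` -/
def lastZ (k : ℕ) : List Bool → ℤ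
  | [] => 0
  | b :: l => if loc (pos l + st b) l + 1 = k then pos l + st b else lastZ k l

lemma lastZ_spec {k : ℕ} {l : List Bool} (h : 0 < cnt k l) : k ≤ loc (lastZ k l) l := by
  induction l with
  | nil => simp [cnt] at h
  | cons b l ih =>
    simp only [lastZ]
    split_ifs with hn
    · rw [loc_self]; omega
    · simp only [cnt, if_neg hn, add_zero] at h
      exact (ih h).trans (loc_le_cons _ _ _)

/-- failure flag -/
def Fl (R k : ℕ) (l : List Bool) : Prop := k < mx l ∨ Bad R k l

lemma mx_le_cons (b : Bool) (l : List Bool) : mx l ≤ mx (b :: l) := le_max_left _ _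

lemma Fl_cons {R k : ℕ} {l : List Bool} (b : Bool) (h : Fl R k l) : Fl R k (b :: l) := by
  rcases h with h | h
  · exact Or.inl (lt_of_lt_of_le h (mx_le_cons b l))
  · exact Or.inr (Bad_cons b h)

/-- potential -/
noncomputable def gu (r : ℝ) (R : ℕ) (x : ℤ) : ℝ := 1 - uu r x + r ^ (x + (R : ℤ))

section
variable {p q : ℝ}

lemma gu_harm (hq0 : 0 < q) (hq : q < 1/2) (hpq : p + q = 1) (R : ℕ) {x : ℤ} (hx : x ≠ 0) :
    p * gu (q / p) R (x + 1) + q * gu (q / p) R (x - 1) = gu (q / p) R x := by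
  have h1 := uu_harm hq0 hq hpq hx
  have h2 := harm hq0 hq hpq (x + R)
  unfold gu
  rw [show x + 1 + (R : ℤ) = x + R + 1 by ring, show x - 1 + (R : ℤ) = x + R - 1 by ring]
  linear_combination hpq - h1 + h2

lemma gu_harm_zero (hq0 : 0 < q) (hq : q < 1/2) (hpq : p + q = 1) (R : ℕ) :
    p * gu (q / p) R (0 + 1) + q * gu (q / p) R (0 - 1) = 1 - 2 * q + (q / p) ^ R := by
  have h1 := uu_harm_zero hq hpq
  have h2 := harm hq0 hq hpq (0 + R)
  unfold gu
  rw [show (0:ℤ) + 1 + (R : ℤ) = 0 + R + 1 by ring, show (0:ℤ) - 1 + (R : ℤ) = 0 + R - 1 by ring]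
  have h3 : (q / p) ^ ((0:ℤ) + R) = (q / p) ^ R := by rw [zero_add, zpow_natCast]
  linear_combination hpq - h1 + h2 + h3

lemma zpow_ge {r : ℝ} (hr : 0 < r) (hr1 : r ≤ 1) {m n : ℤ} (h : m ≤ n) : r ^ n ≤ r ^ m := by
  obtain ⟨k, rfl⟩ : ∃ k : ℕ, n = m + k := ⟨(n - m).toNat, by omega⟩
  rw [zpow_add₀ hr.ne', zpow_natCast]
  have := pow_le_one₀ hr.le hr1 (n := k)
  have := zpow_pos hr m
  nlinarith

lemma gu_lower {r : ℝ} (hr : 0 < r) (hr1 : r < 1) (R : ℕ) {x : ℤ} :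
    r ^ R * (1 - r) ≤ gu r R x := by
  have hR : r ^ R ≤ 1 := pow_le_one₀ hr.le hr1.le
  have hR0 : 0 < r ^ R := by positivity
  by_cases h : x ≤ 0
  · unfold gu uu
    rw [if_pos h]
    have := zpow_ge hr hr1.le (by omega : x + (R:ℤ) ≤ (R : ℤ))
    rw [zpow_natCast] at this
    nlinarith
  · unfold gu
    have := uu_le_r hr hr1.le (by omega : 0 < x)
    have := zpow_pos hr (x + (R:ℤ))
    nlinarith

lemma gu_far {r : ℝ} (hr : 0 < r) (hr1 : r < 1) (R : ℕ) {x : ℤ} (hx : (R : ℤ) ≤ |x|) :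
    1 - r ^ R ≤ gu r R x := by
  have hR0 : 0 < r ^ R := by positivity
  by_cases h : x ≤ 0
  · unfold gu uu
    rw [if_pos h]
    rw [abs_of_nonpos h] at hx
    have := zpow_ge hr hr1.le (by omega : x + (R:ℤ) ≤ 0)
    rw [zpow_zero] at this
    linarith
  · unfold gu uu
    rw [if_neg h]
    rw [abs_of_pos (by omega)] at hx
    have := zpow_ge hr hr1.le hx
    rw [zpow_natCast] at this
    have := zpow_pos hr (x + (R:ℤ))
    linarith

/-- the ratio -/
noncomputable def theta (p q : ℝ) (R : ℕ) : ℝ :=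
  (1 - 2 * q + (q / p) ^ R) / (1 - (q / p) ^ R)

lemma upper_hit (hq0 : 0 < q) (hq : q < 1/2) (hpq : p + q = 1) (R : ℕ) (hR : 1 < R)
    (hθ : theta p q R ≤ 1) :
    ∃ C : ℝ, 0 < C ∧ ∀ n k j : ℕ, 0 < j →
      Pr p q n (Hit (fun l => j ≤ cnt k l ∧ ¬ Fl R k l)) ≤ C * theta p q R ^ j := by
  classical
  have hp := p_pos hq hpq
  have hr := r_pos hq0 hq hpq
  have hr1 := r_lt_one hq hpq
  set r := q / p with hrdef
  have hR0 : 0 < r ^ R := by positivity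
  have hR1 : r ^ R < 1 := pow_lt_one₀ hr.le hr1 (by omega)
  set A := 1 - 2 * q + r ^ R with hA
  have hA0 : 0 < A := by linarith
  set t := (1 - r ^ R) / A with ht
  have ht0 : 0 < t := div_pos (by linarith) hA0
  have htt : theta p q R = t⁻¹ := by rw [ht, inv_div, theta]
  have ht1 : 1 ≤ t := by
    rw [htt] at hθ; exact (inv_le_one₀ ht0).1 hθ
  set c₁ := r ^ R * (1 - r) / (A + 1) with hc1
  have hc1p : 0 < c₁ := by
    rw [hc1]; exact div_pos (mul_pos hR0 (by linarith)) (by linarith)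
  have hc1le : c₁ ≤ 1 := by
    rw [hc1, div_le_one (by linarith)]
    nlinarith
  have hc1A : ∀ x, c₁ ≤ gu r R x / A := by
    intro x
    have h := gu_lower hr hr1 R (x := x)
    have h0 : 0 ≤ r ^ R * (1 - r) := mul_nonneg hR0.le (by linarith)
    rw [hc1]
    calc _ ≤ r ^ R * (1 - r) / A := by gcongr; linarith
      _ ≤ _ := by gcongr
  refine ⟨t * c₁⁻¹, by positivity, ?_⟩
  intro n k j hj
  rw [htt]
  set V : List Bool → ℝ := fun l => if Fl R k l then 0 else if cnt k l = 0 then t else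
    t ^ cnt k l * (if pos l = lastZ k l then 1 else gu r R (pos l - lastZ k l) / A) with hV
  have hV0 : ∀ l, 0 ≤ V l := by
    intro l
    have := hc1A (pos l - lastZ k l)
    have : 0 ≤ gu r R (pos l - lastZ k l) / A := by linarith
    simp only [hV]
    split_ifs <;> positivity
  have step : ∀ l b, ¬ Fl R k l → cnt k l ≠ 0 →
      V (b :: l) ≤ t ^ cnt k l * (gu r R (pos l + st b - lastZ k l) / A) := by
    intro l b hl hc
    have hg := hc1A (pos l + st b - lastZ k l)
    have hg0 : 0 ≤ gu r R (pos l + st b - lastZ k l) / A := by linarith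
    by_cases hf : Fl R k (b :: l)
    · simp only [hV]; rw [if_pos hf]; positivity
    · have hZ := lastZ_spec (Nat.pos_of_ne_zero hc)
      have hy : pos l + st b ≠ lastZ k l := by
        intro h
        apply hf; left
        have h1 := loc_le_mx (pos l + st b) (b :: l)
        rw [loc_self, h] at h1
        omega
      by_cases hn : loc (pos l + st b) l + 1 = k
      · have e1 : cnt k (b :: l) = cnt k l + 1 := by simp [cnt, hn]
        have e2 : lastZ k (b :: l) = pos l + st b := by simp [lastZ, hn]
        have e3 : pos (b :: l) = pos l + st b := rfl
        have hfar : (R : ℤ) ≤ |pos l + st b - lastZ k l| := by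
          by_contra hcon
          rw [not_le, abs_lt] at hcon
          apply hf; right
          have m1 : k ≤ loc (pos l + st b) (b :: l) := by rw [loc_self]; omega
          have m2 : k ≤ loc (lastZ k l) (b :: l) := hZ.trans (loc_le_cons _ _ _)
          rcases lt_or_gt_of_ne hy with h | h
          · refine ⟨pos l + st b, lastZ k l - (pos l + st b), by omega, by omega, m1, ?_⟩
            rw [add_sub_cancel]; exact m2
          · refine ⟨lastZ k l, (pos l + st b) - lastZ k l, by omega, by omega, m2, ?_⟩
            rw [add_sub_cancel]; exact m1
        simp only [hV]
        rw [if_neg hf, e1, if_neg (by omega), e2, e3, if_pos rfl, mul_one, pow_succ]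
        apply mul_le_mul_of_nonneg_left _ (by positivity)
        rw [ht]
        gcongr
        exact gu_far hr hr1 R hfar
      · have e1 : cnt k (b :: l) = cnt k l := by simp [cnt, hn]
        have e2 : lastZ k (b :: l) = lastZ k l := by simp [lastZ, hn]
        have e3 : pos (b :: l) = pos l + st b := rfl
        simp only [hV]
        rw [if_neg hf, e1, if_neg hc, e2, e3, if_neg hy]
  have hsup : ∀ l, p * V (true :: l) + q * V (false :: l) ≤ V l := by
    intro l
    by_cases hf : Fl R k l
    · have e : ∀ b, V (b :: l) = 0 := fun b => by simp only [hV]; rw [if_pos (Fl_cons b hf)]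
      rw [e, e]; simpa using hV0 l
    by_cases hc : cnt k l = 0
    · have e : ∀ b, V (b :: l) ≤ t := by
        intro b
        simp only [hV]
        split_ifs with h1 h2 h3
        · exact ht0.le
        · exact le_rfl
        · by_cases hn : loc (pos l + st b) l + 1 = k
          · simp [cnt, hn, hc]
          · simp [cnt, hn, hc] at h2
        · by_cases hn : loc (pos l + st b) l + 1 = k
          · simp [lastZ, hn, pos] at h3
          · simp [cnt, hn, hc] at h2
      have e' : V l = t := by simp only [hV]; rw [if_neg hf, if_pos hc]
      rw [e']
      nlinarith [e true, e false]
    · have k1 := mul_le_mul_of_nonneg_left (step l true hf hc) hp.le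
      have k2 := mul_le_mul_of_nonneg_left (step l false hf hc) hq0.le
      refine le_trans (add_le_add k1 k2) (le_of_eq ?_)
      have s1 : st true = 1 := rfl
      have s2 : st false = -1 := rfl
      rw [s1, s2]
      simp only [hV]
      rw [if_neg hf, if_neg hc]
      rw [show pos l + 1 - lastZ k l = pos l - lastZ k l + 1 by ring,
        show pos l + -1 - lastZ k l = pos l - lastZ k l - 1 by ring]
      split_ifs with hz
      · rw [hz, sub_self]
        have := gu_harm_zero hq0 hq hpq R
        rw [← hrdef, ← hA] at this
        have h2 : t ^ cnt k l * 1 = t ^ cnt k l * (A / A) := by rw [div_self hA0.ne']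
        rw [h2]
        nth_rewrite 3 [← this]
        ring
      · have := gu_harm hq0 hq hpq R (x := pos l - lastZ k l) (by omega)
        rw [← hrdef] at this
        rw [← this]; ring
  have hV1 : V [] ≤ t := by
    simp only [hV]; split_ifs with h1 h2
    · exact ht0.le
    · exact le_rfl
    · simp [cnt] at h2
    · simp [cnt] at h2
  have := Pr_hit_le hp.le hq0.le hpq n (A := fun l => j ≤ cnt k l ∧ ¬ Fl R k l)
    (f := fun l => (c₁⁻¹ * t⁻¹ ^ j) * V l) (fun l => by have := hV0 l; positivity) ?_ ?_
  · refine this.trans ?_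
    calc c₁⁻¹ * t⁻¹ ^ j * V [] ≤ c₁⁻¹ * t⁻¹ ^ j * t := by gcongr
      _ = _ := by ring
  · rintro l ⟨h1, h2⟩
    have hVl : t ^ j * c₁ ≤ V l := by
      simp only [hV]
      rw [if_neg h2, if_neg (by omega)]
      have a1 : t ^ j ≤ t ^ cnt k l := pow_le_pow_right₀ ht1 h1
      apply mul_le_mul a1 _ hc1p.le (by positivity)
      split_ifs
      · exact hc1le
      · exact hc1A _
    calc 1 = (c₁⁻¹ * t⁻¹ ^ j) * (t ^ j * c₁) := by rw [inv_pow]; field_simp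
      _ ≤ _ := by gcongr
  · intro l
    have := mul_le_mul_of_nonneg_left (hsup l) (by positivity : 0 ≤ c₁⁻¹ * t⁻¹ ^ j)
    linarith

end
end FavW


namespace FavW

/-- rightmost favourite -/
def zmx : List Bool → ℤ
  | [] => 0
  | b :: l => if loc (pos l + st b) l = mx l then pos l + st b else
      if loc (pos l + st b) l + 1 = mx l then max (zmx l) (pos l + st b) else zmx l

lemma zmx_spec {l : List Bool} (h : 0 < mx l) :
    loc (zmx l) l = mx l ∧ ∀ z, loc z l = mx l → z ≤ zmx l := by
  induction l with
  | nil => simp [mx] at h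
  | cons b l ih =>
    by_cases h1 : loc (pos l + st b) l = mx l
    · have e : mx (b :: l) = mx l + 1 := by simp only [mx]; omega
      have e2 : zmx (b :: l) = pos l + st b := by simp [zmx, h1]
      rw [e, e2, loc_self, h1]
      refine ⟨rfl, fun z hz => ?_⟩
      by_cases hy : pos l + st b = z
      · exact hy.ge
      · rw [loc_ne hy] at hz
        have := loc_le_mx z l
        omega
    · have hlt := lt_of_le_of_ne (loc_le_mx (pos l + st b) l) h1
      obtain ⟨i1, i2⟩ := ih (by omega)
      have e : mx (b :: l) = mx l := by simp only [mx]; omega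
      have hne : pos l + st b ≠ zmx l := by intro h; rw [h] at hlt; omega
      by_cases h2 : loc (pos l + st b) l + 1 = mx l
      · have e2 : zmx (b :: l) = max (zmx l) (pos l + st b) := by simp only [zmx]; rw [if_neg h1, if_pos h2]
        rw [e, e2]
        constructor
        · rcases le_total (zmx l) (pos l + st b) with h | h
          · rw [max_eq_right h, loc_self, h2]
          · rw [max_eq_left h, loc_ne hne, i1]
        · intro z hz
          by_cases hy : pos l + st b = z
          · exact le_trans hy.ge (le_max_right _ _)
          · rw [loc_ne hy] at hz
            exact le_trans (i2 z hz) (le_max_left _ _)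
      · have e2 : zmx (b :: l) = zmx l := by simp only [zmx]; rw [if_neg h1, if_neg h2]
        rw [e, e2]
        refine ⟨by rw [loc_ne hne, i1], fun z hz => ?_⟩
        by_cases hy : pos l + st b = z
        · subst hy; rw [loc_self] at hz; omega
        · rw [loc_ne hy] at hz
          exact i2 z hz

/-- success: at least `j k` favourites at some level `k ≥ K` -/
def Good (K : ℕ) (j : ℕ → ℕ) (l : List Bool) : Prop := K ≤ mx l ∧ j (mx l) ≤ cnt (mx l) l

section
variable {p q : ℝ}

lemma lower_hit (hq0 : 0 < q) (hq : q < 1/2) (hpq : p + q = 1) (K K' : ℕ) (hK : 0 < K)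
    (j : ℕ → ℕ) (n : ℕ) :
    Pr p q n (fun l => ¬ Hit (Good K j) l ∧ K' < mx l) ≤
      Real.exp (-∑ m ∈ Finset.Icc K K', (1 - 2 * q) ^ (j m - 1)) := by
  classical
  have hp := p_pos hq hpq
  have hr := r_pos hq0 hq hpq
  have hr1 := r_lt_one hq hpq
  set r := q / p with hrdef
  set β := 1 - 2 * q with hβ
  have hβ0 : 0 < β := by linarith
  have hβ1 : β ≤ 1 := by linarith
  set W : ℕ → ℕ → ℝ := fun m i => if K ≤ m ∧ m ≤ K' then β ^ (j m - i) else 0 with hW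
  have hW0 : ∀ m i, 0 ≤ W m i := by intro m i; simp only [hW]; split_ifs <;> positivity
  have hW1 : ∀ m i, W m i ≤ 1 := by
    intro m i; simp only [hW]; split_ifs
    · exact pow_le_one₀ hβ0.le hβ1
    · norm_num
  set Pi : ℕ → ℝ := fun k => ∏ m ∈ Finset.Ioc k K', (1 - W m 1) with hPi
  have hPi0 : ∀ k, 0 ≤ Pi k := fun k =>
    Finset.prod_nonneg (fun m _ => by have := hW1 m 1; linarith)
  have hPis : ∀ k, (1 - W (k + 1) 1) * Pi (k + 1) = Pi k := by
    intro k
    by_cases hk : k + 1 ≤ K'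
    · simp only [hPi]
      have : Finset.Ioc k K' = insert (k + 1) (Finset.Ioc (k + 1) K') := by
        ext x; simp only [Finset.mem_Ioc, Finset.mem_insert]; omega
      rw [this, Finset.prod_insert (by simp)]
    · have e1 : W (k + 1) 1 = 0 := by simp only [hW]; rw [if_neg (by omega)]
      simp only [hPi]
      rw [e1, Finset.Ioc_eq_empty (by omega), Finset.Ioc_eq_empty (by omega)]; simp
  set v : List Bool → ℝ := fun l => if pos l = zmx l then W (mx l) (cnt (mx l) l) else
    if zmx l < pos l then W (mx l) (cnt (mx l) l + 1) * (1 - r ^ (pos l - zmx l)) else 0 with hv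
  have hr01 : ∀ x : ℤ, 0 ≤ x → 0 ≤ 1 - r ^ x ∧ 1 - r ^ x ≤ 1 := by
    intro x hx
    have h1 := zpow_ge hr hr1.le hx
    have h2 := zpow_pos hr x
    rw [zpow_zero] at h1
    constructor <;> linarith
  have hv0 : ∀ l, 0 ≤ v l := by
    intro l; simp only [hv]; split_ifs with h1 h2
    · exact hW0 _ _
    · exact mul_nonneg (hW0 _ _) (hr01 _ (by omega)).1
    · exact le_rfl
  have hv1 : ∀ l, v l ≤ 1 := by
    intro l; simp only [hv]; split_ifs with h1 h2
    · exact hW1 _ _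
    · exact mul_le_one₀ (hW1 _ _) (hr01 _ (by omega)).1 (hr01 _ (by omega)).2
    · norm_num
  set U : List Bool → ℝ := fun l => if Hit (Good K j) l then 0 else (1 - v l) * Pi (mx l) with hU
  have hU0 : ∀ l, 0 ≤ U l := by
    intro l; simp only [hU]; split_ifs
    · exact le_rfl
    · exact mul_nonneg (by have := hv1 l; linarith) (hPi0 _)
  have hUle : ∀ l, U l ≤ (1 - v l) * Pi (mx l) := by
    intro l; simp only [hU]; split_ifs
    · exact mul_nonneg (by have := hv1 l; linarith) (hPi0 _)
    · exact le_rfl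
  set e : List Bool → ℤ → ℝ := fun l y =>
    if zmx l < y then W (mx l) (cnt (mx l) l + 1) * (1 - r ^ (y - zmx l)) else 0 with he
  have step : ∀ l b, U (b :: l) ≤ (1 - e l (pos l + st b)) * Pi (mx l) := by
    intro l b
    refine (hUle _).trans ?_
    have epos : pos (b :: l) = pos l + st b := rfl
    by_cases h1 : loc (pos l + st b) l = mx l
    · have e1 : mx (b :: l) = mx l + 1 := by simp only [mx]; omega
      have e2 : zmx (b :: l) = pos l + st b := by simp [zmx, h1]
      have e3 : cnt (mx l + 1) (b :: l) = 1 := by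
        simp [cnt, h1, cnt_eq_zero (Nat.lt_succ_self (mx l))]
      have e4 : v (b :: l) = W (mx l + 1) 1 := by
        simp only [hv]; rw [epos, e1, e2, if_pos rfl, e3]
      have e5 : e l (pos l + st b) = 0 := by
        simp only [he]
        by_cases h0 : 0 < mx l
        · rw [if_neg (not_lt.2 ((zmx_spec h0).2 _ h1))]
        · have : W (mx l) (cnt (mx l) l + 1) = 0 := by
            simp only [hW]; rw [if_neg (by omega)]
          rw [this]; simp
      rw [e1, e4, e5, hPis]; linarith
    · have hlt := lt_of_le_of_ne (loc_le_mx (pos l + st b) l) h1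
      obtain ⟨i1, i2⟩ := zmx_spec (by omega : 0 < mx l)
      have e1 : mx (b :: l) = mx l := by simp only [mx]; omega
      have hne : pos l + st b ≠ zmx l := by intro h; rw [h] at hlt; omega
      rw [e1]
      apply mul_le_mul_of_nonneg_right _ (hPi0 _)
      suffices e l (pos l + st b) ≤ v (b :: l) by linarith
      by_cases h3 : zmx l < pos l + st b
      · by_cases h2 : loc (pos l + st b) l + 1 = mx l
        · have e2 : zmx (b :: l) = pos l + st b := by
            simp only [zmx]; rw [if_neg h1, if_pos h2, max_eq_right h3.le]
          have e3 : cnt (mx l) (b :: l) = cnt (mx l) l + 1 := by simp [cnt, h2]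
          simp only [hv, he]
          rw [epos, e1, e2, if_pos rfl, e3, if_pos h3]
          exact mul_le_of_le_one_right (hW0 _ _) (hr01 _ (by omega)).2
        · have e2 : zmx (b :: l) = zmx l := by simp only [zmx]; rw [if_neg h1, if_neg h2]
          have e3 : cnt (mx l) (b :: l) = cnt (mx l) l := by simp [cnt, h2]
          simp only [hv, he]
          rw [epos, e1, e2, if_neg hne, e3, if_pos h3]
      · have : e l (pos l + st b) = 0 := by simp only [he]; rw [if_neg h3]
        rw [this]; exact hv0 _
  have hsup : ∀ l, p * U (true :: l) + q * U (false :: l) ≤ U l := by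
    intro l
    by_cases hh : Hit (Good K j) l
    · have e : ∀ b, U (b :: l) = 0 := fun b => by
        simp only [hU]; rw [if_pos (show Hit (Good K j) (b :: l) from Or.inl hh)]
      rw [e, e]; simpa using hU0 l
    · have k1 := mul_le_mul_of_nonneg_left (step l true) hp.le
      have k2 := mul_le_mul_of_nonneg_left (step l false) hq0.le
      refine le_trans (add_le_add k1 k2) ?_
      have s1 : st true = 1 := rfl
      have s2 : st false = -1 := rfl
      rw [s1, s2, ← sub_eq_add_neg]
      have eU : U l = (1 - v l) * Pi (mx l) := by simp only [hU]; rw [if_neg hh]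
      rw [eU]
      have hvv : v l ≤ p * e l (pos l + 1) + q * e l (pos l - 1) := by
        rcases lt_trichotomy (pos l) (zmx l) with hx | hx | hx
        · have e0 : v l = 0 := by
            simp only [hv]; rw [if_neg (by omega), if_neg (by omega)]
          have e1 : e l (pos l - 1) = 0 := by simp only [he]; rw [if_neg (by omega)]
          have e2 : e l (pos l + 1) = 0 := by simp only [he]; rw [if_neg (by omega)]
          rw [e0, e1, e2]; simp
        · have e0 : v l = W (mx l) (cnt (mx l) l) := by
            simp only [hv]; rw [if_pos hx]
          have e1 : e l (pos l - 1) = 0 := by simp only [he]; rw [if_neg (by omega)]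
          have e2 : e l (pos l + 1) = W (mx l) (cnt (mx l) l + 1) * (1 - r) := by
            simp only [he]; rw [if_pos (by omega), hx, add_sub_cancel_left, zpow_one]
          rw [e0, e1, e2]
          have e3 : p * (1 - r) = β := by
            rw [hrdef, hβ]; field_simp; linarith
          have e4 : W (mx l) (cnt (mx l) l) ≤ β * W (mx l) (cnt (mx l) l + 1) := by
            simp only [hW]
            split_ifs with hc
            · have hng : cnt (mx l) l < j (mx l) := by
                by_contra hcon
                exact hh (Hit_self ⟨hc.1, not_lt.1 hcon⟩)
              rw [show j (mx l) - cnt (mx l) l = (j (mx l) - (cnt (mx l) l + 1)) + 1 by omega,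
                pow_succ, mul_comm]
            · simp
          rw [← e3] at e4
          linarith
        · have e0 : v l = W (mx l) (cnt (mx l) l + 1) * (1 - r ^ (pos l - zmx l)) := by
            simp only [hv]; rw [if_neg (by omega), if_pos hx]
          have e1 : e l (pos l - 1) =
              W (mx l) (cnt (mx l) l + 1) * (1 - r ^ (pos l - zmx l - 1)) := by
            simp only [he]
            by_cases hx1 : zmx l < pos l - 1
            · rw [if_pos hx1, show pos l - 1 - zmx l = pos l - zmx l - 1 by ring]
            · rw [if_neg hx1, show pos l - zmx l - 1 = 0 by omega]; simp
          have e2 : e l (pos l + 1) =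
              W (mx l) (cnt (mx l) l + 1) * (1 - r ^ (pos l - zmx l + 1)) := by
            simp only [he]
            rw [if_pos (by omega), show pos l + 1 - zmx l = pos l - zmx l + 1 by ring]
          rw [e0, e1, e2]
          have := harm hq0 hq hpq (pos l - zmx l)
          rw [← hrdef] at this
          apply le_of_eq
          linear_combination W (mx l) (cnt (mx l) l + 1) * this - W (mx l) (cnt (mx l) l + 1) * hpq
      have := mul_le_mul_of_nonneg_right hvv (hPi0 (mx l))
      have h3 : p * ((1 - e l (pos l + 1)) * Pi (mx l)) + q * ((1 - e l (pos l - 1)) * Pi (mx l))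
        = Pi (mx l) - (p * e l (pos l + 1) + q * e l (pos l - 1)) * Pi (mx l) := by
        linear_combination Pi (mx l) * hpq
      rw [h3]
      linarith
  have hmain : Pr p q n (fun l => ¬ Hit (Good K j) l ∧ K' < mx l) ≤ Ex p q n U := by
    apply Pr_le_Ex hp.le hq0.le n hU0
    rintro l _ ⟨h1, h2⟩
    have hW' : ∀ i, W (mx l) i = 0 := fun i => by simp only [hW]; rw [if_neg (by omega)]
    have e0 : v l = 0 := by simp only [hv, hW']; simp
    have e1 : Pi (mx l) = 1 := by simp only [hPi]; rw [Finset.Ioc_eq_empty (by omega)]; simp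
    simp only [hU]
    rw [if_neg h1, e0, e1]; simp
  refine hmain.trans ((Ex_super hp.le hq0.le n hsup).trans ((hUle []).trans ?_))
  have m0 : mx [] = 0 := rfl
  have : (1 - v []) * Pi (mx []) ≤ Pi 0 := by
    rw [m0]; nlinarith [hv0 [], hPi0 0]
  refine this.trans ?_
  rw [← Finset.sum_neg_distrib, Real.exp_sum]
  simp only [hPi]
  have hsub : Finset.Icc K K' ⊆ Finset.Ioc 0 K' := by
    intro x; simp only [Finset.mem_Icc, Finset.mem_Ioc]; omega
  rw [← Finset.prod_subset hsub]
  · apply Finset.prod_le_prod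
    · intro m _; have := hW1 m 1; linarith
    · intro m hm
      have hm' := Finset.mem_Icc.1 hm
      have : W m 1 = β ^ (j m - 1) := by simp only [hW]; rw [if_pos hm']
      rw [this]
      have := Real.add_one_le_exp (-β ^ (j m - 1)); linarith
  · intro m _ hm
    have : W m 1 = 0 := by simp only [hW]; rw [if_neg (fun h => hm (Finset.mem_Icc.2 h))]
    rw [this]; simp

end
end FavW

set_option linter.unusedSectionVars false
namespace FavW

/-- history of a step sequence, newest first -/
def hs (x : ℕ → ℤ) : ℕ → List Bool
  | 0 => []
  | n + 1 => decide (x n = 1) :: hs x n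

lemma hs_congr {x y : ℕ → ℤ} : ∀ n, (∀ i < n, x i = y i) → hs x n = hs y n := by
  intro n
  induction n with
  | zero => intro _; rfl
  | succ n ih =>
    intro h
    simp only [hs]
    rw [h n (Nat.lt_succ_self n), ih (fun i hi => h i (by omega))]

/-- history of the walk -/
def hist (X : ℕ → Ω → ℤ) (n : ℕ) (ω : Ω) : List Bool := hs (fun i => X i ω) n

lemma hist_succ (X : ℕ → Ω → ℤ) (n : ℕ) (ω : Ω) :
    hist X (n+1) ω = decide (X n ω = 1) :: hist X n ω := rfl

noncomputable def GG (n : ℕ) (v : ∀ _ : Finset.range n, ℤ) : List Bool :=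
  hs (fun i => if h : i ∈ Finset.range n then v ⟨i, h⟩ else 0) n

lemma hist_eq_GG (X : ℕ → Ω → ℤ) (n : ℕ) (ω : Ω) :
    hist X n ω = GG n (fun i : Finset.range n => X i ω) := by
  unfold hist GG
  apply hs_congr
  intro i hi
  simp [hi]

variable [MeasurableSpace Ω] {P : Measure Ω} {X : ℕ → Ω → ℤ} {p q : ℝ}

lemma meas_hist (hX : ∀ i, Measurable (X i)) (n : ℕ) {β : Type*} [MeasurableSpace β]
    (g : List Bool → β) : Measurable (fun ω => g (hist X n ω)) := by
  simp_rw [hist_eq_GG]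
  have h1 : Measurable (fun v : (∀ _ : Finset.range n, ℤ) => g (GG n v)) :=
    measurable_of_countable _
  have h2 : Measurable (fun ω => (fun i : Finset.range n => X i ω)) :=
    measurable_pi_lambda _ (fun i => hX i)
  exact h1.comp h2

lemma indep_hist [IsProbabilityMeasure P] (hX : ∀ i, Measurable (X i)) (hI : iIndepFun X P) (n : ℕ)
    (f : ℤ → ℝ≥0∞) (g : List Bool → ℝ≥0∞) :
    ∫⁻ ω, f (X n ω) * g (hist X n ω) ∂P = (∫⁻ ω, f (X n ω) ∂P) * ∫⁻ ω, g (hist X n ω) ∂P := by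
  have h := hI.indepFun_finset {n} (Finset.range n) (by simp) hX
  have h1 : Measurable (fun v : (∀ _ : Finset.range n, ℤ) => g (GG n v)) :=
    measurable_of_countable _
  have h2 : Measurable (fun v : (∀ _ : ({n} : Finset ℕ), ℤ) => f (v ⟨n, by simp⟩)) :=
    measurable_of_countable _
  have h3 := h.comp h2 h1
  have := lintegral_mul_eq_lintegral_mul_lintegral_of_indepFun
    (f := fun ω => f (X n ω)) (g := fun ω => g (hist X n ω))
    ((measurable_of_countable f).comp (hX n)) (meas_hist hX n g)
    (by
      have e : (fun ω => g (hist X n ω)) =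
          (fun v => g (GG n v)) ∘ fun a (i : Finset.range n) => X i a := by
        funext ω
        simp [hist_eq_GG]
      rw [e]
      exact h3)
  simpa using this

lemma Ex_nonneg (hp : 0 ≤ p) (hq : 0 ≤ q) (n : ℕ) : ∀ {f : List Bool → ℝ},
    (∀ l, 0 ≤ f l) → 0 ≤ Ex p q n f := by
  induction n with
  | zero => intro f h; exact h []
  | succ n ih =>
    intro f h
    apply ih
    intro l
    have := h (true :: l)
    have := h (false :: l)
    positivity

lemma prob_ne_one [IsProbabilityMeasure P] (hX : IsAsymmetricSRW P X p q) (hpq : p + q = 1)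
    (hp : 0 ≤ p) (n : ℕ) :
    P {ω | ¬ X n ω = 1} = ENNReal.ofReal q := by
  have hm : MeasurableSet {ω | X n ω = 1} := hX.1 n (measurableSet_singleton 1)
  have := prob_compl_eq_one_sub (μ := P) hm
  have e : {ω | X n ω = 1}ᶜ = {ω | ¬ X n ω = 1} := rfl
  rw [e] at this
  rw [this, hX.2.2.1, ← ENNReal.ofReal_one, ← ENNReal.ofReal_sub _ hp]
  congr 1; linarith

lemma lint_hist [IsProbabilityMeasure P] (hX : IsAsymmetricSRW P X p q) (hpq : p + q = 1)
    (hp : 0 ≤ p) (hq : 0 ≤ q) (n : ℕ) : ∀ (f : List Bool → ℝ), (∀ l, 0 ≤ f l) →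
    ∫⁻ ω, ENNReal.ofReal (f (hist X n ω)) ∂P = ENNReal.ofReal (Ex p q n f) := by
  induction n with
  | zero => intro f hf; simp [hist, hs, Ex]
  | succ n ih =>
    intro f hf
    have e : ∀ ω, ENNReal.ofReal (f (hist X (n+1) ω)) =
        ({1} : Set ℤ).indicator 1 (X n ω) * ENNReal.ofReal (f (true :: hist X n ω))
        + ({1}ᶜ : Set ℤ).indicator 1 (X n ω) * ENNReal.ofReal (f (false :: hist X n ω)) := by
      intro ω
      rw [hist_succ]
      by_cases h : X n ω = 1 <;> simp [h]
    simp_rw [e]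
    rw [lintegral_add_left]
    · rw [indep_hist hX.1 hX.2.1 n _ (fun l => ENNReal.ofReal (f (true :: l))),
        indep_hist hX.1 hX.2.1 n _ (fun l => ENNReal.ofReal (f (false :: l)))]
      have i1 : ∫⁻ ω, ({1} : Set ℤ).indicator 1 (X n ω) ∂P = ENNReal.ofReal p := by
        rw [← hX.2.2.1 n]
        have : (fun ω => ({1} : Set ℤ).indicator (1 : ℤ → ℝ≥0∞) (X n ω)) =
          ({ω | X n ω = 1}).indicator 1 := by
          funext ω; simp [Set.indicator]
        rw [this]
        exact lintegral_indicator_one (hX.1 n (measurableSet_singleton 1))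
      have i2 : ∫⁻ ω, ({1}ᶜ : Set ℤ).indicator 1 (X n ω) ∂P = ENNReal.ofReal q := by
        rw [← prob_ne_one hX hpq hp n]
        have : (fun ω => ({1}ᶜ : Set ℤ).indicator (1 : ℤ → ℝ≥0∞) (X n ω)) =
          ({ω | ¬ X n ω = 1}).indicator 1 := by
          funext ω; simp [Set.indicator]
        rw [this]
        exact lintegral_indicator_one
          (hX.1 n (measurableSet_singleton 1).compl : MeasurableSet (X n ⁻¹' {1}ᶜ))
      rw [i1, i2, ih (fun l => f (true :: l)) (fun l => hf _),
        ih (fun l => f (false :: l)) (fun l => hf _)]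
      have a1 := Ex_nonneg hp hq n (f := fun l => f (true :: l)) (fun l => hf _)
      have a2 := Ex_nonneg hp hq n (f := fun l => f (false :: l)) (fun l => hf _)
      rw [← ENNReal.ofReal_mul hp, ← ENNReal.ofReal_mul hq,
        ← ENNReal.ofReal_add (by positivity) (by positivity)]
      congr 1
      simp only [Ex]
      rw [Ex_add, Ex_smul, Ex_smul]
    · exact ((measurable_of_countable (({1} : Set ℤ).indicator (1 : ℤ → ℝ≥0∞))).comp (hX.1 n)).mul
        (meas_hist hX.1 n (fun l => ENNReal.ofReal (f (true :: l))))

lemma meas_set (hX : ∀ i, Measurable (X i)) (n : ℕ) (A : List Bool → Prop) :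
    MeasurableSet {ω | A (hist X n ω)} := by
  have := meas_hist hX n (β := Prop) A
  exact measurableSet_setOfPred.2 this

lemma prob_hist [IsProbabilityMeasure P] (hX : IsAsymmetricSRW P X p q) (hpq : p + q = 1)
    (hp : 0 ≤ p) (hq : 0 ≤ q) (n : ℕ) (A : List Bool → Prop) :
    P {ω | A (hist X n ω)} = ENNReal.ofReal (Pr p q n A) := by
  classical
  unfold Pr
  rw [← lint_hist hX hpq hp hq n _ (fun l => by split_ifs <;> norm_num)]
  rw [← lintegral_indicator_one (meas_set hX.1 n A)]
  congr 1
  funext ω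
  by_cases h : A (hist X n ω) <;> simp [h]

lemma ae_steps [IsProbabilityMeasure P] (hX : IsAsymmetricSRW P X p q) (hpq : p + q = 1)
    (hp : 0 ≤ p) (hq : 0 ≤ q) : ∀ᵐ ω ∂P, ∀ n, X n ω = 1 ∨ X n ω = -1 := by
  rw [ae_all_iff]
  intro n
  have hm1 : MeasurableSet {ω | X n ω = 1} := hX.1 n (measurableSet_singleton 1)
  have hm2 : MeasurableSet {ω | X n ω = -1} := hX.1 n (measurableSet_singleton (-1))
  have hd : Disjoint {ω | X n ω = 1} {ω | X n ω = -1} := by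
    rw [Set.disjoint_left]
    intro ω h1 h2
    simp only [Set.mem_ofPred_eq] at h1 h2
    omega
  have := measure_union hd hm2 (μ := P)
  rw [hX.2.2.1, hX.2.2.2, ← ENNReal.ofReal_add hp hq, hpq, ENNReal.ofReal_one] at this
  exact (prob_compl_eq_zero_iff (hm1.union hm2)).2 this

lemma hist_length (n : ℕ) (ω : Ω) : (hist X n ω).length = n := by
  induction n with
  | zero => rfl
  | succ n ih => rw [hist_succ, List.length_cons, ih]

lemma S_eq {ω : Ω} (h : ∀ n, X n ω = 1 ∨ X n ω = -1) (n : ℕ) : S X n ω = pos (hist X n ω) := by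
  induction n with
  | zero => simp [S, hist, hs, pos]
  | succ n ih =>
    have : S X (n+1) ω = S X n ω + X n ω := by simp [S, Finset.sum_range_succ]
    rw [this, ih, hist_succ]
    show _ = pos (hist X n ω) + st _
    rcases h n with h | h <;> simp [h, st]

lemma loc_eq {ω : Ω} (h : ∀ n, X n ω = 1 ∨ X n ω = -1) (z : ℤ) (n : ℕ) :
    localTime X z n ω = loc z (hist X n ω) := by
  induction n with
  | zero => simp [localTime, hist, hs, loc]
  | succ n ih =>
    rw [hist_succ, loc_cons, ← ih]
    have e : pos (hist X n ω) + st (decide (X n ω = 1)) = S X (n+1) ω := by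
      rw [S_eq h (n+1)]; rfl
    rw [e]
    unfold localTime
    rw [← Finset.insert_Icc_right_eq_Icc_add_one (by omega), Finset.filter_insert]
    split_ifs with h1
    · rw [Finset.card_insert_of_notMem (by simp)]
    · simp

lemma mx_eq {ω : Ω} (h : ∀ n, X n ω = 1 ∨ X n ω = -1) (n : ℕ) :
    maxLocalTime X n ω = mx (hist X n ω) := by
  unfold maxLocalTime
  simp_rw [loc_eq h]
  apply IsGreatest.csSup_eq
  constructor
  · obtain ⟨z, hz⟩ := exists_loc_eq_mx (hist X n ω)
    exact ⟨z, hz⟩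
  · rintro _ ⟨z, rfl⟩
    exact loc_le_mx _ _

lemma mx_pos {n : ℕ} (hn : 0 < n) (ω : Ω) : 0 < mx (hist X n ω) := by
  obtain ⟨m, rfl⟩ : ∃ m, n = m + 1 := ⟨n - 1, by omega⟩
  rw [hist_succ]
  exact lt_of_lt_of_le (Nat.succ_pos _) (le_max_right _ _)

lemma fav_eq {ω : Ω} (h : ∀ n, X n ω = 1 ∨ X n ω = -1) {n : ℕ} (hn : 0 < n) :
    (favSites X n ω).ncard = cnt (mx (hist X n ω)) (hist X n ω) := by
  rw [← (cnt_spec _ (mx_pos hn ω) (hist X n ω)).2]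
  congr 1
  ext z
  simp only [favSites, Set.mem_ofPred_eq, loc_eq h, mx_eq h]
  exact ⟨fun h => h.ge, fun h => le_antisymm (loc_le_mx _ _) h⟩

lemma mx_hist_mono (ω : Ω) : Monotone (fun n => mx (hist X n ω)) :=
  monotone_nat_of_le_succ (fun n => by rw [hist_succ]; exact mx_le_cons _ _)

lemma bad_hist_mono {R k m n : ℕ} (hmn : m ≤ n) (ω : Ω) (h : Bad R k (hist X m ω)) :
    Bad R k (hist X n ω) := by
  induction n, hmn using Nat.le_induction with
  | base => exact h
  | succ n _ ih => rw [hist_succ]; exact Bad_cons _ ih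

lemma hit_hist_iff {A : List Bool → Prop} (n : ℕ) (ω : Ω) :
    Hit A (hist X n ω) ↔ ∃ m ≤ n, A (hist X m ω) := by
  induction n with
  | zero => simp [hist, hs, Hit]
  | succ n ih =>
    rw [hist_succ]
    show (Hit A (hist X n ω) ∨ A (hist X (n+1) ω)) ↔ _
    rw [ih]
    constructor
    · rintro (⟨m, hm, h⟩ | h)
      · exact ⟨m, by omega, h⟩
      · exact ⟨n+1, le_rfl, h⟩
    · rintro ⟨m, hm, h⟩
      rcases Nat.lt_or_ge m (n+1) with h1 | h1
      · exact Or.inl ⟨m, by omega, h⟩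
      · have : m = n+1 := by omega
        subst this; exact Or.inr h

end FavW

set_option linter.unusedSectionVars false
namespace FavW

variable [MeasurableSpace Ω] {P : Measure Ω} {X : ℕ → Ω → ℤ} {p q : ℝ}

lemma bc [IsProbabilityMeasure P] (hX : IsAsymmetricSRW P X p q) (hpq : p + q = 1)
    (hp : 0 ≤ p) (hq : 0 ≤ q) (A : ℕ → List Bool → Prop) (N : ℕ → ℕ) (a : ℕ → ℝ)
    (ha : Summable a) (h : ∀ᶠ k in atTop, Pr p q (N k) (A k) ≤ a k) :
    ∀ᵐ ω ∂P, ∀ᶠ k in atTop, ¬ A k (hist X (N k) ω) := by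
  have hs : Summable (fun k => Pr p q (N k) (A k)) := by
    apply Summable.of_norm_bounded_eventually_nat ha
    filter_upwards [h] with k hk
    rwa [Real.norm_of_nonneg (Pr_nonneg hp hq hpq _ _)]
  have := ae_eventually_notMem (μ := P) (s := fun k => {ω | A k (hist X (N k) ω)}) (by
    simp_rw [prob_hist hX hpq hp hq]
    exact hs.tsum_ofReal_ne_top)
  exact this

lemma as_horizon [IsProbabilityMeasure P] (hX : IsAsymmetricSRW P X p q) (hq0 : 0 < q)
    (hq : q < 1/2) (hpq : p + q = 1) {N : ℕ → ℕ}
    (hN : ∀ k : ℕ, Pr p q (N k) (fun l => mx l ≤ k) ≤ Real.exp (-k)) :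
    ∀ᵐ ω ∂P, ∀ᶠ k in atTop, k < mx (hist X (N k) ω) := by
  have := bc hX hpq (p_pos hq hpq).le hq0.le (fun k l => mx l ≤ k) N (fun k => Real.exp (-(k:ℝ)))
    Real.summable_exp_neg_nat (Eventually.of_forall hN)
  filter_upwards [this] with ω h
  filter_upwards [h] with k hk
  exact not_le.1 hk

lemma mx_tendsto {ω : Ω} {N : ℕ → ℕ} (h : ∀ᶠ k in atTop, k < mx (hist X (N k) ω)) :
    Tendsto (fun n => mx (hist X n ω)) atTop atTop := by
  apply tendsto_atTop_atTop_of_monotone (mx_hist_mono ω)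
  intro b
  obtain ⟨k, hk, hb⟩ := (h.and (eventually_ge_atTop b)).exists
  exact ⟨N k, by omega⟩

lemma le_N {ω : Ω} {n M : ℕ} (h : mx (hist X n ω) < mx (hist X M ω)) : n ≤ M := by
  by_contra hc
  have := mx_hist_mono (X := X) ω (show M ≤ n by omega)
  simp only at this
  omega

lemma as_mx [IsProbabilityMeasure P] (hX : IsAsymmetricSRW P X p q) (hq0 : 0 < q)
    (hq : q < 1/2) (hpq : p + q = 1) : ∃ C' : ℝ, 0 < C' ∧ 
    ∀ᵐ ω ∂P, ∀ᶠ n : ℕ in atTop, (mx (hist X n ω) : ℝ) ≤ C' * Real.log n + 1 := by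
  obtain ⟨b, C, s, hb0, hb, hC, hs, -, h2⟩ := pair_bound hq0 hq hpq
  have hls : 0 < Real.log s := Real.log_pos hs
  refine ⟨3 / Real.log s, by positivity, ?_⟩
  set C' := 3 / Real.log s with hC'
  have hC'0 : 0 < C' := by positivity
  have := bc hX hpq (p_pos hq hpq).le hq0.le (fun n l => ⌈C' * Real.log n⌉₊ ≤ mx l) (fun n => n)
    (fun n => 3 * C * (n:ℝ) ^ (-2 : ℝ)) ((Real.summable_nat_rpow.2 (by norm_num)).mul_left _) (by
      filter_upwards [eventually_ge_atTop 2] with n hn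
      have hn1 : (1:ℝ) < n := by exact_mod_cast hn
      have hln : 0 < Real.log n := Real.log_pos hn1
      have hk : 0 < ⌈C' * Real.log n⌉₊ := Nat.ceil_pos.2 (by positivity)
      refine (mx_prob (p_pos hq hpq).le hq0.le h2 _ n hk).trans ?_
      have e1 : (s⁻¹) ^ ⌈C' * Real.log n⌉₊ ≤ (n:ℝ) ^ (-3 : ℝ) := by
        rw [← Real.rpow_natCast]
        calc (s⁻¹) ^ ((⌈C' * Real.log n⌉₊ : ℕ) : ℝ) ≤ (s⁻¹) ^ (C' * Real.log n) :=
              Real.rpow_le_rpow_of_exponent_ge (by positivity) (inv_le_one_of_one_le₀ hs.le)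
                (Nat.le_ceil _)
          _ = (n:ℝ) ^ (-3 : ℝ) := by
              rw [Real.rpow_def_of_pos (by positivity), Real.rpow_def_of_pos (by linarith),
                Real.log_inv, hC']
              congr 1
              field_simp
      have e2 : (n:ℝ) ^ (-2:ℝ) = n * (n:ℝ) ^ (-3:ℝ) := by
        rw [show (-2:ℝ) = 1 + (-3) by norm_num, Real.rpow_add (by linarith), Real.rpow_one]
      rw [e2]
      calc (2 * (n:ℝ) + 1) * (C * s⁻¹ ^ ⌈C' * Real.log n⌉₊) ≤ (3 * n) * (C * (n:ℝ) ^ (-3 : ℝ)) := by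
            gcongr
            linarith
        _ = _ := by ring)
  filter_upwards [this] with ω h
  filter_upwards [h, eventually_ge_atTop 2] with n hn hn2
  have hn1 : (1:ℝ) < n := by exact_mod_cast hn2
  have hln : 0 < Real.log n := Real.log_pos hn1
  have h3 := Nat.ceil_lt_add_one (show 0 ≤ C' * Real.log n by positivity)
  have h4 : (mx (hist X n ω) : ℝ) ≤ (⌈C' * Real.log n⌉₊ : ℝ) := by
    exact_mod_cast (not_le.1 hn).le
  linarith

lemma theta_tendsto (hq0 : 0 < q) (hq : q < 1/2) (hpq : p + q = 1) :
    Tendsto (fun R => theta p q R) atTop (nhds (1 - 2 * q)) := by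
  have h0 := tendsto_pow_atTop_nhds_zero_of_lt_one (r_pos hq0 hq hpq).le (r_lt_one hq hpq)
  have h1 : Tendsto (fun R : ℕ => (1 - 2 * q + (q / p) ^ R) / (1 - (q / p) ^ R)) atTop
      (nhds ((1 - 2 * q + 0) / (1 - 0))) := by
    apply Tendsto.div
    · exact tendsto_const_nhds.add h0
    · exact tendsto_const_nhds.sub h0
    · norm_num
  simpa [theta] using h1

lemma as_upper [IsProbabilityMeasure P] (hX : IsAsymmetricSRW P X p q) (hq0 : 0 < q)
    (hq : q < 1/2) (hpq : p + q = 1) {c : ℝ} (hc0 : 0 < c) (hc : 1 < c * -Real.log (1 - 2 * q)) :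
    ∀ᵐ ω ∂P, ∀ᶠ n : ℕ in atTop, (cnt (mx (hist X n ω)) (hist X n ω) : ℝ) ≤
      c * Real.log (mx (hist X n ω)) + 1 := by
  have hp := (p_pos hq hpq)
  obtain ⟨b, C, s, hb0, hb, hC, hs, h1, -⟩ := pair_bound hq0 hq hpq
  obtain ⟨N, C₁, hC₁, hN1, hN⟩ := horizon hq0 hq hpq
  -- choose R
  obtain ⟨R, hR, hθ0, hθ1, hθ⟩ : ∃ R : ℕ, 1 < R ∧ 0 < theta p q R ∧ theta p q R < 1 ∧
      1 < c * -Real.log (theta p q R) := by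
    have ht := theta_tendsto hq0 hq hpq
    have hl : Tendsto (fun R => c * -Real.log (theta p q R)) atTop
        (nhds (c * -Real.log (1 - 2 * q))) :=
      ((ht.log (by linarith)).neg).const_mul c
    have e1 := ht.eventually_lt_const (show 1 - 2 * q < 1 by linarith)
    have e2 := ht.eventually_const_lt (show 0 < 1 - 2 * q by linarith)
    have e3 := hl.eventually_const_lt hc
    obtain ⟨R, a1, a2, a3, a4⟩ := (e1.and (e2.and (e3.and (eventually_gt_atTop 1)))).exists
    exact ⟨R, a4, a2, a1, a3⟩
  obtain ⟨C₂, hC₂, hU⟩ := upper_hit hq0 hq hpq R hR hθ1.le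
  set θ := theta p q R with hθd
  -- (b)
  have hB : ∀ᵐ ω ∂P, ∀ᶠ k in atTop, ¬ Bad R k (hist X (N k) ω) := by
    set ρ := b / (2 * q) with hρ
    have hρ0 : 0 < ρ := by positivity
    have hρ1 : ρ < 1 := by rw [hρ, div_lt_one (by positivity)]; exact hb
    have hsum : Summable (fun k : ℕ => ((k:ℝ) + 1) ^ 2 * ρ ^ k) := by
      have := summable_pow_mul_geometric_of_norm_lt_one (R := ℝ) 2
        (r := ρ) (by rwa [Real.norm_of_nonneg hρ0.le])
      have := ((summable_nat_add_iff 1).2 this).mul_left ρ⁻¹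
      refine this.congr (fun k => ?_)
      push_cast
      rw [pow_succ ρ k]
      field_simp
    apply bc hX hpq hp.le hq0.le (fun k => Bad R k) N
      (fun k => (2 * C₁ + 1) * R * C * (((k:ℝ) + 1) ^ 2 * ρ ^ k)) (hsum.mul_left _)
    filter_upwards [eventually_gt_atTop 0] with k hk
    refine (bad_prob hp.le hq0.le h1 R k (N k) hk).trans ?_
    have h2q : 1 ≤ (2 * q)⁻¹ := (one_le_inv₀ (by positivity)).2 (by linarith)
    have e1 : 1 ≤ ((k:ℝ) + 1) ^ 2 * ((2 * q)⁻¹) ^ k := by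
      have a1 : 1 ≤ ((2 * q)⁻¹) ^ k := one_le_pow₀ h2q
      have a2 : 1 ≤ ((k:ℝ) + 1) ^ 2 := one_le_pow₀ (by linarith [Nat.cast_nonneg (α := ℝ) k])
      nlinarith
    have e2 : 2 * (N k : ℝ) + 1 ≤ (2 * C₁ + 1) * (((k:ℝ) + 1) ^ 2 * ((2 * q)⁻¹) ^ k) := by
      have := hN1 k
      nlinarith
    calc (2 * (N k : ℝ) + 1) * R * (C * b ^ k)
        ≤ ((2 * C₁ + 1) * (((k:ℝ) + 1) ^ 2 * ((2 * q)⁻¹) ^ k)) * R * (C * b ^ k) := by gcongr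
      _ = _ := by rw [hρ, div_eq_mul_inv, mul_pow]; ring
  -- (c)
  have hCc : ∀ᵐ ω ∂P, ∀ᶠ k : ℕ in atTop,
      ¬ Hit (fun l => ⌈c * Real.log k⌉₊ ≤ cnt k l ∧ ¬ Fl R k l) (hist X (N k) ω) := by
    apply bc hX hpq hp.le hq0.le
      (fun (k : ℕ) => Hit (fun l => ⌈c * Real.log k⌉₊ ≤ cnt k l ∧ ¬ Fl R k l)) N
      (fun k => C₂ * (k:ℝ) ^ (c * Real.log θ))
      ((Real.summable_nat_rpow.2 (by linarith)).mul_left _)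
    filter_upwards [eventually_ge_atTop 2] with n hn
    have hn1 : (1:ℝ) < n := by exact_mod_cast hn
    have hln : 0 < Real.log n := Real.log_pos hn1
    have hk : 0 < ⌈c * Real.log n⌉₊ := Nat.ceil_pos.2 (by positivity)
    refine (hU (N n) n _ hk).trans ?_
    gcongr
    rw [← Real.rpow_natCast]
    calc θ ^ ((⌈c * Real.log n⌉₊ : ℕ) : ℝ) ≤ θ ^ (c * Real.log n) :=
          Real.rpow_le_rpow_of_exponent_ge hθ0 hθ1.le (Nat.le_ceil _)
      _ = _ := by
          rw [Real.rpow_def_of_pos hθ0, Real.rpow_def_of_pos (by linarith)]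
          congr 1
          ring
  filter_upwards [hB, hCc, as_horizon hX hq0 hq hpq hN] with ω w1 w2 w3
  have ht := mx_tendsto w3
  filter_upwards [ht.eventually w1, ht.eventually w2, ht.eventually w3,
    ht.eventually (eventually_ge_atTop 1)] with n v1 v2 v3 v4
  set k := mx (hist X n ω) with hk
  have hnk : n ≤ N k := le_N v3
  have hnb : ¬ Fl R k (hist X n ω) := by
    rintro (h | h)
    · omega
    · exact v1 (bad_hist_mono hnk ω h)
  have hlt : cnt k (hist X n ω) < ⌈c * Real.log k⌉₊ := by
    by_contra hcon
    exact v2 ((hit_hist_iff _ _).2 ⟨n, hnk, not_lt.1 hcon, hnb⟩)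
  have hk1 : (1:ℝ) ≤ k := by exact_mod_cast v4
  have h3 := Nat.ceil_lt_add_one (show 0 ≤ c * Real.log k from
    mul_nonneg hc0.le (Real.log_nonneg hk1))
  have h4 : (cnt k (hist X n ω) : ℝ) ≤ (⌈c * Real.log k⌉₊ : ℝ) := by
    exact_mod_cast hlt.le
  linarith

end FavW

set_option linter.unusedSectionVars false
namespace FavW

variable [MeasurableSpace Ω] {P : Measure Ω} {X : ℕ → Ω → ℤ} {p q : ℝ}

lemma sum_div_Icc (K : ℕ) :
    Tendsto (fun K' : ℕ => ∑ m ∈ Finset.Icc K K', (1 / (m:ℝ))) atTop atTop := by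
  have h := (not_summable_iff_tendsto_nat_atTop_of_nonneg
    (f := fun m : ℕ => 1 / (m:ℝ)) (fun m => by positivity)).1 Real.not_summable_one_div_natCast
  have h2 := (h.comp (tendsto_add_atTop_nat 1)).atTop_add
    (tendsto_const_nhds (x := -∑ m ∈ Finset.range K, (1 / (m:ℝ))))
  refine h2.congr' ?_
  filter_upwards [eventually_ge_atTop K] with K' hK'
  have e : Finset.Icc K K' = Finset.Ico K (K' + 1) := by ext; simp
  rw [e, Finset.sum_Ico_eq_sub _ (by omega)]
  simp only [Function.comp]
  ring

lemma as_lower [IsProbabilityMeasure P] (hX : IsAsymmetricSRW P X p q) (hq0 : 0 < q)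
    (hq : q < 1/2) (hpq : p + q = 1) {c : ℝ} (hc0 : 0 < c) (hc : c * -Real.log (1 - 2 * q) < 1) :
    ∀ᵐ ω ∂P, ∀ K : ℕ, ∃ n, K ≤ mx (hist X n ω) ∧
      c * Real.log (mx (hist X n ω)) ≤ (cnt (mx (hist X n ω)) (hist X n ω) : ℝ) := by
  have hp := (p_pos hq hpq)
  obtain ⟨N, C₁, hC₁, hN1, hN⟩ := horizon hq0 hq hpq
  set j : ℕ → ℕ := fun m => ⌈c * Real.log m⌉₊ with hj
  have key : ∀ K : ℕ, ∀ᵐ ω ∂P, ∃ n, Good (K+1) j (hist X n ω) := by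
    intro K
    have hle : ∀ K' : ℕ, P {ω | ¬ ∃ n, Good (K+1) j (hist X n ω)} ≤
        ENNReal.ofReal (Real.exp (-∑ m ∈ Finset.Icc (K+1) K', (1 / (m:ℝ)))) +
        ENNReal.ofReal (Real.exp (-(K':ℝ))) := by
      intro K'
      calc P {ω | ¬ ∃ n, Good (K+1) j (hist X n ω)}
          ≤ P ({ω | ¬ Hit (Good (K+1) j) (hist X (N K') ω) ∧ K' < mx (hist X (N K') ω)} ∪
            {ω | mx (hist X (N K') ω) ≤ K'}) := by
            apply measure_mono
            intro ω hω
            rcases Nat.lt_or_ge K' (mx (hist X (N K') ω)) with h | h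
            · left
              refine ⟨?_, h⟩
              rw [hit_hist_iff]
              rintro ⟨m, -, hm⟩
              exact hω ⟨m, hm⟩
            · right; exact h
        _ ≤ _ := measure_union_le _ _
        _ ≤ _ := by
            rw [prob_hist hX hpq hp.le hq0.le (N K')
                (fun l => ¬ Hit (Good (K+1) j) l ∧ K' < mx l),
              prob_hist hX hpq hp.le hq0.le (N K') (fun l => mx l ≤ K')]
            gcongr
            · refine (lower_hit hq0 hq hpq (K+1) K' (by omega) j (N K')).trans ?_
              apply Real.exp_le_exp.2
              apply neg_le_neg
              apply Finset.sum_le_sum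
              intro m hm
              have hm1 : (1:ℝ) ≤ m := by
                have := (Finset.mem_Icc.1 hm).1
                exact_mod_cast (by omega : 1 ≤ m)
              have hlm := Real.log_nonneg hm1
              have h12 : 0 < 1 - 2 * q := by linarith
              have hjm : ((j m - 1 : ℕ) : ℝ) ≤ c * Real.log m := by
                have h3 := Nat.ceil_lt_add_one (show 0 ≤ c * Real.log m by positivity)
                rcases Nat.eq_zero_or_pos (j m) with h | h
                · rw [h]; simp; positivity
                · rw [Nat.cast_sub h]
                  simp only [hj] at *
                  push_cast
                  linarith
              rw [← Real.rpow_natCast]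
              calc 1 / (m:ℝ) = (m:ℝ) ^ (-1 : ℝ) := by rw [Real.rpow_neg_one, one_div]
                _ ≤ (m:ℝ) ^ (c * Real.log (1 - 2 * q)) :=
                    Real.rpow_le_rpow_of_exponent_le hm1 (by linarith)
                _ = (1 - 2 * q) ^ (c * Real.log m) := by
                    rw [Real.rpow_def_of_pos h12, Real.rpow_def_of_pos (by linarith)]
                    congr 1
                    ring
                _ ≤ _ := Real.rpow_le_rpow_of_exponent_ge h12 (by linarith) hjm
            · exact hN K'
    have hlim : Tendsto (fun K' : ℕ =>
        ENNReal.ofReal (Real.exp (-∑ m ∈ Finset.Icc (K+1) K', (1 / (m:ℝ)))) +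
        ENNReal.ofReal (Real.exp (-(K':ℝ)))) atTop (nhds 0) := by
      have a1 := ENNReal.tendsto_ofReal (Real.tendsto_exp_neg_atTop_nhds_zero.comp
        (sum_div_Icc (K+1)))
      have a2 := ENNReal.tendsto_ofReal (Real.tendsto_exp_neg_atTop_nhds_zero.comp
        (tendsto_natCast_atTop_atTop (R := ℝ)))
      have := a1.add a2
      simpa using this
    have h0 := ge_of_tendsto' hlim hle
    exact le_antisymm h0 bot_le
  filter_upwards [ae_all_iff.2 key] with ω h K
  obtain ⟨n, h1, h2⟩ := h K
  refine ⟨n, by omega, ?_⟩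
  exact (Nat.le_ceil _).trans (by exact_mod_cast h2)

lemma loglog_tendsto : Tendsto (fun n : ℕ => Real.log (Real.log n)) atTop atTop :=
  Real.tendsto_log_atTop.comp (Real.tendsto_log_atTop.comp tendsto_natCast_atTop_atTop)

lemma upper_ratio {m : ℕ → ℕ} {a : ℕ → ℕ} {c C' : ℝ} (hc : 0 < c) (hC' : 0 < C')
    (hm : ∀ᶠ n : ℕ in atTop, (m n : ℝ) ≤ C' * Real.log n + 1)
    (hm0 : ∀ᶠ n in atTop, 1 ≤ m n)
    (ha : ∀ᶠ n in atTop, (a n : ℝ) ≤ c * Real.log (m n) + 1) {ε : ℝ} (hε : 0 < ε) :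
    ∀ᶠ n : ℕ in atTop, (a n : ℝ) / Real.log (Real.log n) ≤ c + ε := by
  have hl : Tendsto (fun n : ℕ => Real.log n) atTop atTop :=
    Real.tendsto_log_atTop.comp tendsto_natCast_atTop_atTop
  filter_upwards [hm, hm0, ha, hl.eventually_ge_atTop 1, loglog_tendsto.eventually_gt_atTop 0,
    loglog_tendsto.eventually_ge_atTop ((c * Real.log (C' + 1) + 1) / ε)] with n h1 h2 h3 h4 h5 h6
  rw [div_le_iff₀ hε] at h6
  rw [div_le_iff₀ h5]
  have hm1 : (1:ℝ) ≤ m n := by exact_mod_cast h2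
  have : Real.log (m n) ≤ Real.log (C' + 1) + Real.log (Real.log n) := by
    rw [← Real.log_mul (by positivity) (by linarith)]
    apply Real.log_le_log (by linarith)
    nlinarith
  nlinarith

lemma lower_ratio {C₁ : ℝ} (hq0 : 0 < q) (hq : q < 1/2) (hC₁ : 0 < C₁) {N : ℕ → ℕ}
    (hN1 : ∀ k, (N k : ℝ) ≤ C₁ * (k+1)^2 * ((2*q)⁻¹)^k)
    {m : ℕ → ℕ} {a : ℕ → ℕ} {c : ℝ} (hc : 0 < c)
    (hmn : ∀ n, m n ≤ n)
    (hm : ∀ᶠ k in atTop, ∀ n, m n = k → n ≤ N k)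
    (ha : ∀ K : ℕ, ∃ n, K ≤ m n ∧ c * Real.log (m n) ≤ (a n : ℝ)) {ε : ℝ} (hε : 0 < ε) :
    ∃ᶠ n : ℕ in atTop, c - ε ≤ (a n : ℝ) / Real.log (Real.log n) := by
  have hl : Tendsto (fun n : ℕ => Real.log n) atTop atTop :=
    Real.tendsto_log_atTop.comp tendsto_natCast_atTop_atTop
  have h2q : 1 ≤ (2 * q)⁻¹ := (one_le_inv₀ (by positivity)).2 (by linarith)
  set D : ℝ := |Real.log C₁| + 2 + Real.log ((2*q)⁻¹) with hD
  have hD0 : 0 < D := by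
    have := Real.log_nonneg h2q
    positivity
  have hev : ∀ᶠ n : ℕ in atTop, 1 ≤ Real.log n ∧ 0 < Real.log (Real.log n) ∧
      (c * Real.log D) / ε ≤ Real.log (Real.log n) :=
    (hl.eventually_ge_atTop 1).and ((loglog_tendsto.eventually_gt_atTop 0).and
      (loglog_tendsto.eventually_ge_atTop _))
  obtain ⟨n0, hn0⟩ := eventually_atTop.1 hev
  obtain ⟨k0, hk0⟩ := eventually_atTop.1 hm
  rw [frequently_atTop]
  intro A
  obtain ⟨n, h1, h2⟩ := ha (A + n0 + k0 + 1)
  have hmn' := hmn n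
  refine ⟨n, by omega, ?_⟩
  obtain ⟨v1, v2, v3⟩ := hn0 n (by omega)
  have hnN := hk0 (m n) (by omega) n rfl
  set k := m n with hk
  have hk1 : (1:ℝ) ≤ k := by exact_mod_cast (by omega : 1 ≤ k)
  have hn1 : (0:ℝ) < n := by exact_mod_cast (by omega : 0 < n)
  have hlog : Real.log n ≤ D * k := by
    have b1 : Real.log n ≤ Real.log (C₁ * (k+1)^2 * ((2*q)⁻¹)^k) :=
      Real.log_le_log hn1 (le_trans (by exact_mod_cast hnN) (hN1 k))
    rw [Real.log_mul (by positivity) (by positivity), Real.log_mul (by positivity) (by positivity),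
      Real.log_pow, Real.log_pow] at b1
    have b2 : Real.log ((k:ℝ) + 1) ≤ k := by
      have := Real.log_le_sub_one_of_pos (show (0:ℝ) < k + 1 by positivity)
      linarith
    have b3 : Real.log C₁ ≤ |Real.log C₁| * k := by
      have := le_abs_self (Real.log C₁)
      have := abs_nonneg (Real.log C₁)
      nlinarith
    push_cast at b1
    rw [hD]
    nlinarith
  have hll : Real.log (Real.log n) ≤ Real.log D + Real.log k := by
    rw [← Real.log_mul (by positivity) (by positivity)]
    exact Real.log_le_log (by linarith) hlog
  rw [div_le_iff₀ hε] at v3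
  rw [le_div_iff₀ v2]
  nlinarith

end FavW

/-- Almost surely, `limsup_{n→∞} #K(n) / log log n = -1 / log(1 - 2q)`. -/
theorem limsup_card_favSites
    [MeasurableSpace Ω] (P : Measure Ω) [IsProbabilityMeasure P]
    (X : ℕ → Ω → ℤ) (p q : ℝ) (hq0 : 0 < q) (hq : q < 1/2) (hpq : p + q = 1)
    (hX : IsAsymmetricSRW P X p q) :
    ∀ᵐ ω ∂P,
      Filter.limsup (fun n : ℕ => ((favSites X n ω).ncard : ℝ) / Real.log (Real.log n)) atTop
        = -1 / Real.log (1 - 2*q) := by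
  have hp := FavW.p_pos hq hpq
  set A := -Real.log (1 - 2 * q) with hA
  have hA0 : 0 < A := by
    have := Real.log_neg (show 0 < 1 - 2 * q by linarith) (by linarith)
    linarith
  have hL : -1 / Real.log (1 - 2 * q) = A⁻¹ := by
    rw [hA, inv_neg, neg_div, one_div]
  rw [hL]
  obtain ⟨N, C₁, hC₁, hN1, hN⟩ := FavW.horizon hq0 hq hpq
  obtain ⟨C', hC', hmx⟩ := FavW.as_mx hX hq0 hq hpq
  have hU : ∀ᵐ ω ∂P, ∀ i : ℕ, ∀ᶠ n : ℕ in atTop,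
      (FavW.cnt (FavW.mx (FavW.hist X n ω)) (FavW.hist X n ω) : ℝ) ≤
      (A⁻¹ + 1 / ((i:ℝ) + 1)) * Real.log (FavW.mx (FavW.hist X n ω)) + 1 := by
    rw [ae_all_iff]
    intro i
    apply FavW.as_upper hX hq0 hq hpq (by positivity)
    rw [← hA, add_mul, inv_mul_cancel₀ hA0.ne']
    have : 0 < 1 / ((i:ℝ) + 1) * A := by positivity
    linarith
  have hLo : ∀ᵐ ω ∂P, ∀ i : ℕ, ∀ K : ℕ, ∃ n, K ≤ FavW.mx (FavW.hist X n ω) ∧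
      (A⁻¹ * (1 - 1 / ((i:ℝ) + 2))) * Real.log (FavW.mx (FavW.hist X n ω)) ≤
      (FavW.cnt (FavW.mx (FavW.hist X n ω)) (FavW.hist X n ω) : ℝ) := by
    rw [ae_all_iff]
    intro i
    have h1 : 1 / ((i:ℝ) + 2) < 1 := by
      rw [div_lt_one (by positivity)]
      linarith [Nat.cast_nonneg (α := ℝ) i]
    have h2 : 0 < 1 - 1 / ((i:ℝ) + 2) := by linarith
    apply FavW.as_lower hX hq0 hq hpq (by positivity)
    rw [← hA, mul_right_comm, inv_mul_cancel₀ hA0.ne', one_mul]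
    have : 0 < 1 / ((i:ℝ) + 2) := by positivity
    linarith
  filter_upwards [FavW.ae_steps hX hpq hp.le hq0.le, hmx, hU, hLo,
    FavW.as_horizon hX hq0 hq hpq hN] with ω hs w1 w2 w3 w4
  set u : ℕ → ℝ := fun n => ((favSites X n ω).ncard : ℝ) / Real.log (Real.log n) with hu
  have ht := FavW.mx_tendsto w4
  have hueq : ∀ᶠ n : ℕ in atTop, u n =
      (FavW.cnt (FavW.mx (FavW.hist X n ω)) (FavW.hist X n ω) : ℝ) / Real.log (Real.log n) := by
    filter_upwards [eventually_gt_atTop 0] with n hn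
    rw [hu]
    simp only
    rw [FavW.fav_eq hs hn]
  have up : ∀ i : ℕ, ∀ ε : ℝ, 0 < ε → ∀ᶠ n in atTop, u n ≤ A⁻¹ + 1 / ((i:ℝ) + 1) + ε := by
    intro i ε hε
    have := FavW.upper_ratio (m := fun n => FavW.mx (FavW.hist X n ω))
      (a := fun n => FavW.cnt (FavW.mx (FavW.hist X n ω)) (FavW.hist X n ω))
      (by positivity) hC' w1 (ht.eventually_ge_atTop 1) (w2 i) hε
    filter_upwards [this, hueq] with n h1 h2
    rw [h2]; exact h1
  have lo : ∀ i : ℕ, ∀ ε : ℝ, 0 < ε →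
      ∃ᶠ n in atTop, A⁻¹ * (1 - 1 / ((i:ℝ) + 2)) - ε ≤ u n := by
    intro i ε hε
    have h1 : 1 / ((i:ℝ) + 2) < 1 := by
      rw [div_lt_one (by positivity)]
      linarith [Nat.cast_nonneg (α := ℝ) i]
    have h2 : 0 < 1 - 1 / ((i:ℝ) + 2) := by linarith
    have := FavW.lower_ratio hq0 hq hC₁ hN1 (m := fun n => FavW.mx (FavW.hist X n ω))
      (a := fun n => FavW.cnt (FavW.mx (FavW.hist X n ω)) (FavW.hist X n ω))
      (by positivity) (fun n => (FavW.mx_le_length _).trans (FavW.hist_length n ω).le)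
      (by
        filter_upwards [w4] with k hk n hn
        exact FavW.le_N (X := X) (ω := ω) (by omega)) (w3 i) hε
    refine (this.and_eventually hueq).mono (fun n h => ?_)
    rw [h.2]; exact h.1
  have hnn : ∀ᶠ n in atTop, 0 ≤ u n := by
    filter_upwards [FavW.loglog_tendsto.eventually_gt_atTop 0] with n hn
    exact div_nonneg (Nat.cast_nonneg _) hn.le
  have hbdd : IsBoundedUnder (· ≤ ·) atTop u := ⟨_, (up 0 1 one_pos)⟩
  have hcob : IsCoboundedUnder (· ≤ ·) atTop u :=
    IsBoundedUnder.isCoboundedUnder_le ⟨0, hnn⟩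
  apply le_antisymm
  · have hl : Tendsto (fun i : ℕ => A⁻¹ + 1 / ((i:ℝ) + 1) + 1 / ((i:ℝ) + 1)) atTop (nhds A⁻¹) := by
      have h0 := tendsto_one_div_add_atTop_nhds_zero_nat (𝕜 := ℝ)
      have := (tendsto_const_nhds (x := A⁻¹)).add h0 |>.add h0
      simpa using this
    exact ge_of_tendsto' hl (fun i => limsup_le_of_le hcob (up i _ (by positivity)))
  · have hl : Tendsto (fun i : ℕ => A⁻¹ * (1 - 1 / ((i:ℝ) + 2)) - 1 / ((i:ℝ) + 1)) atTop
        (nhds A⁻¹) := by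
      have h0 := tendsto_one_div_add_atTop_nhds_zero_nat (𝕜 := ℝ)
      have h1 := h0.comp (tendsto_add_atTop_nat 1)
      have := (((tendsto_const_nhds (x := (1:ℝ))).sub h1).const_mul A⁻¹).sub h0
      simp only [sub_zero, mul_one] at this
      refine this.congr (fun i => ?_)
      simp only [Function.comp]
      push_cast
      rw [show (i:ℝ) + 1 + 1 = i + 2 by ring]
    exact le_of_tendsto' hl (fun i => le_limsup_of_frequently_le (lo i _ (by positivity)) hbdd)
end

section
/- The probability that the random walk never returns to its starting point equals 1 - 2q, i.e. P(S_i ≠ 0 for all i = 1, 2, ...) = 1 - 2q. -/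
open MeasureTheory ProbabilityTheory Filter Set
open scoped ENNReal NNReal

variable {Ω : Type*}

def AvSet (X : ℕ → Ω → ℤ) (x : ℤ) (n : ℕ) : Set Ω :=
  {ω | ∀ i : ℕ, 1 ≤ i → i ≤ n → x + S X i ω ≠ 0}

noncomputable def gAv (p q : ℝ) : ℕ → ℤ → ℝ
  | 0, _ => 1
  | n+1, x => p * (if x + 1 = 0 then 0 else gAv p q n (x+1))
      + q * (if x - 1 = 0 then 0 else gAv p q n (x-1))

theorem measurable_S {m : MeasurableSpace Ω} (X : ℕ → Ω → ℤ) (h : ∀ i, Measurable (X i)) (n : ℕ) :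
    Measurable (S X n) := by
  unfold S
  exact Finset.measurable_fun_sum _ (fun i _ => h i)

theorem measurableSet_AvSet {m : MeasurableSpace Ω} (X : ℕ → Ω → ℤ) (h : ∀ i, Measurable (X i))
    (x : ℤ) (n : ℕ) : MeasurableSet (AvSet X x n) := by
  have : AvSet X x n = ⋂ i : ℕ, ⋂ (_ : 1 ≤ i), ⋂ (_ : i ≤ n), (S X i) ⁻¹' {z | x + z ≠ 0} := by
    ext ω; simp [AvSet]
  rw [this]
  refine MeasurableSet.iInter fun i => MeasurableSet.iInter fun _ => MeasurableSet.iInter fun _ => ?_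
  exact measurable_S X h i (MeasurableSet.of_discrete)

theorem S_shift (X : ℕ → Ω → ℤ) (n : ℕ) (ω : Ω) :
    S X (n+1) ω = X 0 ω + S (fun i => X (i+1)) n ω := by
  unfold S
  rw [Finset.sum_range_succ']; ring

theorem AvSet_inter (X : ℕ → Ω → ℤ) (x : ℤ) (n : ℕ) (c : ℤ) :
    AvSet X x (n+1) ∩ {ω | X 0 ω = c} =
      {ω | X 0 ω = c} ∩ (if x + c = 0 then ∅ else AvSet (fun i => X (i+1)) (x+c) n) := by
  ext ω
  simp only [mem_inter_iff, mem_setOf_eq]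
  rw [and_comm]
  refine and_congr_right fun hc => ?_
  split_ifs with h
  · simp only [mem_empty_iff_false, iff_false]
    intro hA
    refine hA 1 le_rfl (by omega) ?_
    rw [S_shift]; simp [S, hc, h]
  · constructor
    · intro hA i hi hin
      have := hA (i+1) (by omega) (by omega)
      rw [S_shift, hc] at this
      rwa [add_assoc]
    · intro hA i hi hin
      obtain ⟨j, rfl⟩ : ∃ j, i = j + 1 := ⟨i-1, by omega⟩
      rw [S_shift, hc, ← add_assoc]
      rcases Nat.eq_zero_or_pos j with rfl | hj
      · simpa [S] using h
      · exact hA j hj (by omega)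

theorem srw_shift [MeasurableSpace Ω] {P : Measure Ω} {X : ℕ → Ω → ℤ} {p q : ℝ}
    (hX : IsAsymmetricSRW P X p q) : IsAsymmetricSRW P (fun i => X (i+1)) p q :=
  ⟨fun i => hX.1 _, hX.2.1.precomp (g := fun i : ℕ => i+1) (fun a b h => by simpa using h),
    fun i => hX.2.2.1 _, fun i => hX.2.2.2 _⟩

theorem indep_part [MeasurableSpace Ω] (P : Measure Ω) [IsProbabilityMeasure P]
    (X : ℕ → Ω → ℤ) (hm : ∀ i, Measurable (X i)) (hi : iIndepFun X P) (c y : ℤ) (n : ℕ) :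
    P.real ({ω | X 0 ω = c} ∩ AvSet (fun i => X (i+1)) y n)
      = P.real {ω | X 0 ω = c} * P.real (AvSet (fun i => X (i+1)) y n) := by
  have h := indep_iSup_of_disjoint (m := fun i => MeasurableSpace.comap (X i) inferInstance)
    (fun i => (hm i).comap_le) hi (S := {0}) (T := {i | 1 ≤ i}) (by simp)
  rw [Indep_iff] at h
  have hle : ∀ (T : Set ℕ) (i : ℕ), i ∈ T →
      Measurable[⨆ i ∈ T, MeasurableSpace.comap (X i) inferInstance] (X i) := by
    intro T i hi
    rw [measurable_iff_comap_le]
    exact le_iSup₂_of_le (f := fun i (_ : i ∈ T) => MeasurableSpace.comap (X i) inferInstance)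
      i hi le_rfl
  have h2 := h {ω | X 0 ω = c} (AvSet (fun i => X (i+1)) y n)
    (hle {0} 0 rfl (MeasurableSet.of_discrete (s := {c})))
    (measurableSet_AvSet _ (fun i => hle {i | 1 ≤ i} (i+1) (Nat.le_add_left 1 i)) y n)
  simp only [Measure.real, h2, ENNReal.toReal_mul]

theorem prob_AvSet [MeasurableSpace Ω] (P : Measure Ω) [IsProbabilityMeasure P]
    (p q : ℝ) (hp0 : 0 ≤ p) (hq0 : 0 ≤ q) (hpq : p + q = 1) (n : ℕ) :
    ∀ (X : ℕ → Ω → ℤ) (_ : IsAsymmetricSRW P X p q) (x : ℤ),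
    P.real (AvSet X x n) = gAv p q n x := by
  induction n with
  | zero =>
    intro X hX x
    have : AvSet X x 0 = univ := by
      ext ω; simp only [AvSet, mem_setOf_eq, mem_univ, iff_true]; intro i h1 h2; omega
    simp [this, gAv]
  | succ n ih =>
    intro X hX x
    have h1 : P.real {ω | X 0 ω = 1} = p := by simp [Measure.real, hX.2.2.1, hp0]
    have h2 : P.real {ω | X 0 ω = -1} = q := by simp [Measure.real, hX.2.2.2, hq0]
    have m1 : MeasurableSet {ω | X 0 ω = 1} := hX.1 0 (MeasurableSet.of_discrete (s := {1}))
    have m2 : MeasurableSet {ω | X 0 ω = -1} := hX.1 0 (MeasurableSet.of_discrete (s := {-1}))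
    have hd : Disjoint {ω | X 0 ω = 1} {ω | X 0 ω = -1} := by
      rw [Set.disjoint_left]; intro ω ha hb; simp only [mem_setOf_eq] at ha hb; omega
    have hu : P.real ({ω | X 0 ω = 1} ∪ {ω | X 0 ω = -1}) = 1 := by
      rw [measureReal_union hd m2, h1, h2, hpq]
    have hc : P.real ({ω | X 0 ω = 1} ∪ {ω | X 0 ω = -1})ᶜ = 0 := by
      rw [probReal_compl_eq_one_sub (m1.union m2), hu]; simp
    have key : P.real (AvSet X x (n+1)) = P.real (AvSet X x (n+1) ∩ {ω | X 0 ω = 1})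
        + P.real (AvSet X x (n+1) ∩ {ω | X 0 ω = -1}) := by
      rw [← measureReal_inter_add_diff (s := AvSet X x (n+1)) (m1.union m2), inter_union_distrib_left,
        measureReal_union (hd.mono inter_subset_right inter_subset_right)
          ((measurableSet_AvSet X hX.1 x _).inter m2)]
      have : P.real (AvSet X x (n+1) \ ({ω | X 0 ω = 1} ∪ {ω | X 0 ω = -1})) = 0 :=
        le_antisymm (hc ▸ measureReal_mono (fun ω h => h.2)) measureReal_nonneg
      rw [this, add_zero]
    have part : ∀ c, P.real (AvSet X x (n+1) ∩ {ω | X 0 ω = c}) =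
        P.real {ω | X 0 ω = c} * (if x + c = 0 then 0 else gAv p q n (x+c)) := by
      intro c
      rw [AvSet_inter]
      split_ifs with h
      · simp
      · rw [indep_part P X hX.1 hX.2.1, ih _ (srw_shift hX)]
    rw [key, part, part, h1, h2, gAv]
    rfl

theorem tendsto_AvSet [MeasurableSpace Ω] (P : Measure Ω) [IsProbabilityMeasure P]
    (X : ℕ → Ω → ℤ) (hm : ∀ i, Measurable (X i)) (x : ℤ) :
    Tendsto (fun n => P.real (AvSet X x n)) atTop
      (nhds (P.real {ω | ∀ i : ℕ, 1 ≤ i → x + S X i ω ≠ 0})) := by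
  have he : {ω | ∀ i : ℕ, 1 ≤ i → x + S X i ω ≠ 0} = ⋂ n, AvSet X x n := by
    ext ω
    simp only [AvSet, mem_setOf_eq, mem_iInter]
    exact ⟨fun h n i h1 _ => h i h1, fun h i h1 => h i i h1 le_rfl⟩
  rw [he]
  refine (ENNReal.tendsto_toReal (measure_ne_top _ _)).comp ?_
  refine tendsto_measure_iInter_atTop
    (fun n => (measurableSet_AvSet X hm x n).nullMeasurableSet) ?_ ⟨0, measure_ne_top _ _⟩
  intro a b hab ω h i h1 h2
  exact h i h1 (h2.trans hab)

theorem rec_solve (u : ℕ → ℝ) (a b : ℝ) (ha : 0 < a) (hab : a + b = 1) (h0 : u 0 = 0)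
    (hr : ∀ n, u (n+1) = a * u (n+2) + b * u n) (n : ℕ) :
    u (n+1) - u n = u 1 * (b/a)^n := by
  induction n with
  | zero => simp [h0]
  | succ n ih =>
    have h : u (n+2) - u (n+1) = (b/a) * (u (n+1) - u n) := by
      field_simp
      have hb : b = 1 - a := by linarith
      have := hr n
      subst hb
      linarith
    rw [show n+1+1 = n+2 from rfl, h, ih]; ring

theorem rec_sum (u : ℕ → ℝ) (a b : ℝ) (ha : 0 < a) (hab : a + b = 1) (h0 : u 0 = 0)
    (hr : ∀ n, u (n+1) = a * u (n+2) + b * u n) (n : ℕ) :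
    u n * (1 - b/a) = u 1 * (1 - (b/a)^n) := by
  induction n with
  | zero => simp [h0]
  | succ n ih =>
    have := rec_solve u a b ha hab h0 hr n
    have h2 : u (n+1) = u n + u 1 * (b/a)^n := by linarith
    rw [h2, add_mul, ih]; ring

theorem gAv_lower (p q : ℝ) (hp : 0 < p) (hq : 0 < q) (hpq : p + q = 1) (n : ℕ) :
    ∀ x : ℕ, 1 - (q/p)^(x+1) ≤ gAv p q n ((x:ℤ)+1) := by
  induction n with
  | zero => intro x; simp only [gAv]; have : 0 < (q/p)^(x+1) := by positivity
            linarith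
  | succ n ih =>
    intro x
    have h1 : 1 - (q/p)^(x+2) ≤ (if (x:ℤ)+1+1 = 0 then 0 else gAv p q n ((x:ℤ)+1+1)) := by
      rw [if_neg (by omega)]
      have := ih (x+1)
      push_cast at this
      exact this
    have h2 : 1 - (q/p)^x ≤ (if (x:ℤ)+1-1 = 0 then 0 else gAv p q n ((x:ℤ)+1-1)) := by
      rcases x with _ | x
      · simp
      · rw [if_neg (by push_cast; omega)]
        have := ih x
        push_cast
        rwa [add_sub_cancel_right]
    have e : 1 - (q/p)^(x+1) = p * (1 - (q/p)^(x+2)) + q * (1 - (q/p)^x) := by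
      have : p * (q/p)^(x+2) + q * (q/p)^x = (q/p)^(x+1) := by
        have h : p * (q/p) = q := by field_simp
        calc _ = (q/p)^x * ((p * (q/p)) * (q/p) + q) := by ring
          _ = (q/p)^x * ((q/p) * (p+q)) := by
            rw [h]
            have : q * (q/p) + q = (q/p) * (p+q) := by field_simp; ring
            rw [this]
          _ = _ := by rw [hpq]; ring
      linear_combination this - hpq
    rw [e, gAv]
    gcongr

/-- The probability of never returning to the starting point is `1 - 2q`. -/
theorem prob_no_return
    [MeasurableSpace Ω] (P : Measure Ω) [IsProbabilityMeasure P]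
    (X : ℕ → Ω → ℤ) (p q : ℝ) (hq0 : 0 < q) (hq : q < 1/2) (hpq : p + q = 1)
    (hX : IsAsymmetricSRW P X p q) :
    P {ω | ∀ i : ℕ, 1 ≤ i → S X i ω ≠ 0} = ENNReal.ofReal (1 - 2*q) := by
  have hp : 0 < p := by linarith
  obtain ⟨U, hU⟩ : ∃ U : ℤ → ℝ, U = fun x => P.real {ω | ∀ i : ℕ, 1 ≤ i → x + S X i ω ≠ 0} :=
    ⟨_, rfl⟩
  have hlim : ∀ x, Tendsto (fun n => gAv p q n x) atTop (nhds (U x)) := by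
    intro x
    have := tendsto_AvSet P X hX.1 x
    simp only [prob_AvSet P p q hp.le hq0.le hpq _ X hX x] at this
    rw [hU]; exact this
  have hU0 : ∀ x, 0 ≤ U x := fun x => by rw [hU]; exact measureReal_nonneg
  have hU1 : ∀ x, U x ≤ 1 := fun x => by rw [hU]; exact measureReal_le_one
  obtain ⟨w, hw⟩ : ∃ w : ℤ → ℝ, w = fun x => if x = 0 then 0 else U x := ⟨_, rfl⟩
  have hlw : ∀ x, Tendsto (fun n => if x = 0 then 0 else gAv p q n x) atTop (nhds (w x)) := by
    intro x
    rw [hw]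
    by_cases h : x = 0
    · simp [h]
    · simpa [h] using hlim x
  have hrec : ∀ x, U x = p * w (x+1) + q * w (x-1) := by
    intro x
    refine tendsto_nhds_unique ((tendsto_add_atTop_iff_nat 1).2 (hlim x)) ?_
    exact ((hlw (x+1)).const_mul p).add ((hlw (x-1)).const_mul q)
  have hw00 : w 0 = 0 := by rw [hw]; simp
  have hwU : ∀ x, x ≠ 0 → w x = U x := fun x h => by rw [hw]; simp [h]
  have hw1 : ∀ x, w x ≤ 1 := by
    intro x
    by_cases h : x = 0
    · rw [h, hw00]; norm_num
    · rw [hwU x h]; exact hU1 x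
  have hr0 : 0 < q/p := by positivity
  have hr1 : q/p < 1 := by rw [div_lt_one hp]; linarith
  -- positive side
  have hpos : w 1 = 1 - q/p := by
    apply le_antisymm
    · have hs := rec_sum (fun n : ℕ => w n) p q hp hpq (by simpa using hw00) (by
        intro n
        have := hrec ((n:ℤ)+1)
        rw [← hwU _ (by omega), add_sub_cancel_right, add_assoc] at this
        push_cast
        exact this)
      have ht : Tendsto (fun n : ℕ => w 1 * (1 - (q/p)^n)) atTop (nhds (w 1 * (1 - 0))) :=
        ((tendsto_pow_atTop_nhds_zero_of_lt_one hr0.le hr1).const_sub 1).const_mul _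
      have := le_of_tendsto' ht (b := 1 - q/p) (fun n => by
        have h1 := hs n
        have h2 := hw1 n
        simp only [Nat.cast_one] at h1
        rw [← h1]
        nlinarith)
      linarith
    · rw [hwU 1 (by norm_num)]
      refine ge_of_tendsto' (hlim 1) (fun n => ?_)
      have := gAv_lower p q hp hq0 hpq n 0
      simpa using this
  -- negative side
  have hneg : w (-1) = 0 := by
    have hs := rec_sum (fun n : ℕ => w (-n)) q p hq0 (by linarith) (by simpa using hw00) (by
        intro n
        have := hrec (-((n:ℤ)+1))
        rw [← hwU _ (by omega)] at this
        push_cast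
        rw [this, show -((n:ℤ)+1)+1 = -n by ring, show -((n:ℤ)+1)-1 = -(n+2) by ring]
        ring)
    have hge : 0 ≤ w (-1) := by rw [hwU _ (by norm_num)]; exact hU0 _
    by_contra hne
    have hpos' : 0 < w (-1) := lt_of_le_of_ne hge (Ne.symm hne)
    have hs1 : 1 < p/q := by rw [one_lt_div hq0]; linarith
    obtain ⟨n, hn⟩ := pow_unbounded_of_one_lt (1 + (p/q - 1)/w (-1)) hs1
    have h1 := hs n
    have h2 := hw1 (-n)
    simp only [Nat.cast_one] at h1
    have h3 : (p/q - 1) < w (-1) * ((p/q)^n - 1) := by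
      have : (p/q - 1)/w (-1) < (p/q)^n - 1 := by linarith
      rw [div_lt_iff₀ hpos'] at this
      linarith
    nlinarith
  have hfin : U 0 = 1 - 2*q := by
    rw [hrec 0]
    simp only [zero_add, zero_sub]
    rw [hpos, hneg]
    have : p * (q/p) = q := by field_simp
    linear_combination hpq - this
  have : P.real {ω | ∀ i : ℕ, 1 ≤ i → S X i ω ≠ 0} = 1 - 2*q := by
    rw [← hfin, hU]; simp
  rw [← this, Measure.real, ENNReal.ofReal_toReal (measure_ne_top _ _)]
end

section
/- For every positive integer m, the probability that the random walk returns to 0 at some time n ≥ m/2 satisfies P(∃ n ≥ m/2 with S_n = 0) ≤ (4pq)^{m/4} / (1 - √(4pq)). -/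
open MeasureTheory ProbabilityTheory Filter Set
open scoped ENNReal NNReal

variable {Ω : Type*}

theorem aux_step [MeasurableSpace Ω] (P : Measure Ω) [IsProbabilityMeasure P]
    (Y : Ω → ℤ) (hY : Measurable Y) (p q : ℝ) (hp0 : 0 ≤ p) (hq0 : 0 ≤ q) (hpq : p + q = 1)
    (h1 : P {ω | Y ω = 1} = ENNReal.ofReal p) (h2 : P {ω | Y ω = -1} = ENNReal.ofReal q)
    (g : ℤ → ℝ≥0∞) :
    ∫⁻ ω, g (Y ω) ∂P = g 1 * ENNReal.ofReal p + g (-1) * ENNReal.ofReal q := by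
  have m1 : MeasurableSet {ω | Y ω = 1} := hY (measurableSet_singleton 1)
  have m2 : MeasurableSet {ω | Y ω = -1} := hY (measurableSet_singleton (-1))
  have hd : Disjoint {ω | Y ω = 1} {ω | Y ω = -1} := by
    rw [Set.disjoint_left]
    intro ω h h'
    simp only [Set.mem_ofPred_eq] at h h'
    omega
  have hae : ∀ᵐ ω ∂P, ω ∈ {ω | Y ω = 1} ∪ {ω | Y ω = -1} := by
    refine (mem_ae_iff_prob_eq_one (m1.union m2)).2 ?_
    rw [measure_union hd m2, h1, h2, ← ENNReal.ofReal_add hp0 hq0, hpq, ENNReal.ofReal_one]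
  have he : ∀ᵐ ω ∂P, g (Y ω) = {ω | Y ω = 1}.indicator (fun _ => g 1) ω
      + {ω | Y ω = -1}.indicator (fun _ => g (-1)) ω := by
    filter_upwards [hae] with ω h
    rcases h with h | h <;> simp only [Set.mem_ofPred_eq] at h <;> simp [Set.indicator, h]
  rw [lintegral_congr_ae he, lintegral_add_left (measurable_const.indicator m1),
    lintegral_indicator_const m1, lintegral_indicator_const m2, h1, h2]

theorem aux_return [MeasurableSpace Ω] (P : Measure Ω) [IsProbabilityMeasure P]
    (X : ℕ → Ω → ℤ) (p q : ℝ) (hp0 : 0 < p) (hq0 : 0 < q) (hpq : p + q = 1)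
    (hX : IsAsymmetricSRW P X p q) (n : ℕ) :
    P {ω | S X n ω = 0} ≤ ENNReal.ofReal (Real.sqrt (4*p*q)) ^ n := by
  obtain ⟨hm, hi, h1, h2⟩ := hX
  set a := Real.sqrt p with ha
  set b := Real.sqrt q with hb
  have ha0 : 0 < a := Real.sqrt_pos.2 hp0
  have hb0 : 0 < b := Real.sqrt_pos.2 hq0
  have haa : a * a = p := Real.mul_self_sqrt hp0.le
  have hbb : b * b = q := Real.mul_self_sqrt hq0.le
  have ht : 0 < b / a := by positivity
  have hr : Real.sqrt (4*p*q) = 2 * a * b := by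
    rw [Real.sqrt_eq_iff_mul_self_eq (by positivity) (by positivity), ← haa, ← hbb]; ring
  let g : ℤ → ℝ≥0∞ := fun z => ENNReal.ofReal ((b / a) ^ z)
  have hg : Measurable g := measurable_of_countable g
  have hstep : ∀ i, ∫⁻ ω, g (X i ω) ∂P = ENNReal.ofReal (Real.sqrt (4*p*q)) := by
    intro i
    rw [aux_step P (X i) (hm i) p q hp0.le hq0.le hpq (h1 i) (h2 i) g]
    simp only [g]
    rw [← ENNReal.ofReal_mul (by positivity), ← ENNReal.ofReal_mul (by positivity),
      ← ENNReal.ofReal_add (by positivity) (by positivity), hr, ← haa, ← hbb]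
    congr 1
    rw [zpow_one, zpow_neg_one]
    field_simp
    ring
  have hS : ∀ ω, g (S X n ω) = ∏ i ∈ Finset.range n, g (X i ω) := by
    intro ω
    unfold S
    induction n with
    | zero => simp [g]
    | succ k ih =>
      rw [Finset.sum_range_succ, Finset.prod_range_succ, ← ih]
      simp only [g]
      rw [zpow_add₀ ht.ne', ENNReal.ofReal_mul (by positivity)]
  have hSm : Measurable (S X n) := by
    unfold S
    exact Finset.measurable_fun_sum _ (fun i _ => hm i)
  have m0 : MeasurableSet {ω | S X n ω = 0} := hSm (measurableSet_singleton 0)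
  calc P {ω | S X n ω = 0} = ∫⁻ ω, {ω | S X n ω = 0}.indicator 1 ω ∂P := by
        rw [lintegral_indicator_one m0]
    _ ≤ ∫⁻ ω, g (S X n ω) ∂P := by
        apply lintegral_mono
        intro ω
        by_cases h : S X n ω = 0 <;> simp [h, g]
    _ = ∏ i ∈ Finset.range n, ∫⁻ ω, g (X i ω) ∂P := by
        simp_rw [hS]
        exact lintegral_prod_eq_prod_lintegral_of_indepFun (Finset.range n)
          (fun i ω => g (X i ω)) (hi.comp (fun _ => g) (fun _ => hg)) (fun i => hg.comp (hm i))
    _ = _ := by simp [hstep]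

/-- For every positive integer `m`,
`P(∃ n ≥ m/2, S_n = 0) ≤ (4pq)^{m/4} / (1 - √(4pq))`. -/
theorem prob_return_late
    [MeasurableSpace Ω] (P : Measure Ω) [IsProbabilityMeasure P]
    (X : ℕ → Ω → ℤ) (p q : ℝ) (hq0 : 0 < q) (hq : q < 1/2) (hpq : p + q = 1)
    (hX : IsAsymmetricSRW P X p q) (m : ℕ) (hm : 1 ≤ m) :
    P {ω | ∃ n : ℕ, (m : ℝ) / 2 ≤ (n : ℝ) ∧ S X n ω = 0}
      ≤ ENNReal.ofReal ((4*p*q) ^ ((m : ℝ)/4) / (1 - Real.sqrt (4*p*q))) := by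
  obtain hp0 : 0 < p := by linarith
  have h4 : 4*p*q < 1 := by nlinarith [mul_self_pos.2 (show p - q ≠ 0 by linarith)]
  have h40 : 0 < 4*p*q := by positivity
  set r := Real.sqrt (4*p*q) with hr
  have hr0 : 0 < r := Real.sqrt_pos.2 h40
  have hr1 : r < 1 := by rw [hr, Real.sqrt_lt' one_pos]; linarith
  have hk : (m : ℝ) / 2 ≤ (⌈(m : ℝ) / 2⌉₊ : ℝ) := Nat.le_ceil _
  set k := ⌈(m : ℝ) / 2⌉₊ with hkdef
  have hsub : {ω | ∃ n : ℕ, (m : ℝ) / 2 ≤ (n : ℝ) ∧ S X n ω = 0}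
      ⊆ ⋃ j : ℕ, {ω | S X (k + j) ω = 0} := by
    rintro ω ⟨n, hn, h0⟩
    have : k ≤ n := Nat.ceil_le.2 hn
    refine Set.mem_iUnion.2 ⟨n - k, ?_⟩
    simpa [Nat.add_sub_cancel' this] using h0
  have hpow : r ^ k ≤ (4*p*q) ^ ((m : ℝ)/4) := by
    have e : (4*p*q) ^ ((m : ℝ)/4) = r ^ ((m : ℝ)/2) := by
      rw [hr, Real.sqrt_eq_rpow, ← Real.rpow_mul h40.le]
      congr 1; ring
    rw [e, ← Real.rpow_natCast]
    exact Real.rpow_le_rpow_of_exponent_ge hr0 hr1.le hk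
  calc P {ω | ∃ n : ℕ, (m : ℝ) / 2 ≤ (n : ℝ) ∧ S X n ω = 0}
      ≤ ∑' j : ℕ, P {ω | S X (k + j) ω = 0} := (measure_mono hsub).trans (measure_iUnion_le _)
    _ ≤ ∑' j : ℕ, ENNReal.ofReal (r ^ k * r ^ j) := by
        refine ENNReal.tsum_le_tsum fun j => ?_
        rw [← pow_add, ENNReal.ofReal_pow hr0.le]
        exact aux_return P X p q hp0 hq0 hpq hX (k + j)
    _ = ENNReal.ofReal (r ^ k * (1 - r)⁻¹) := by
        rw [← ENNReal.ofReal_tsum_of_nonneg (fun j => by positivity)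
          ((summable_geometric_of_lt_one hr0.le hr1).mul_left _), tsum_mul_left,
          tsum_geometric_of_lt_one hr0.le hr1]
    _ ≤ _ := by
        rw [div_eq_mul_inv]
        have : 0 < 1 - r := by linarith
        exact ENNReal.ofReal_le_ofReal (by gcongr)
end
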